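/- arXiv:1503.06939 — 2 statements merged into one kernel-verified Lean document; each statement's English description precedes it below -/
import Mathlib

section
/- Comparison principle, quasilinear case: Assume (M), (J1), (J2) hold and f is uniformly continuous on ℝ^N. If u : ℝ^N → ℝ is a bounded upper semicontinuous viscosity subsolution of −L[u,Du] + u = f in ℝ^N and v : ℝ^N → ℝ is a bounded lower semicontinuous viscosity supersolution of the same equation, then u ≤ v on ℝ^N. -/
set_option autoImplicit false

open MeasureTheory Filter Topology Metric
open scoped InnerProductSpace
open scoped ENNReal NNReal

noncomputable section

/-- `ℝ^n` as a Euclidean space. -/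
abbrev RE (n : ℕ) : Type := EuclideanSpace ℝ (Fin n)

/-- A modulus of continuity: nonnegative, subadditive, tending to `0` at `0⁺`. -/
def IsModulus (ω : ℝ → ℝ) : Prop :=
  (∀ s, 0 ≤ ω s) ∧ (∀ s t, ω (s + t) ≤ ω s + ω t) ∧
    Filter.Tendsto ω (𝓝[>] (0 : ℝ)) (𝓝 0)

/-- Boundedness of a real valued function. -/
def Bdd {N : ℕ} (u : RE N → ℝ) : Prop := ∃ C, ∀ x, |u x| ≤ C

/-- Test functions: bounded `C²` functions. -/
def TestFn {N : ℕ} (φ : RE N → ℝ) : Prop := ContDiff ℝ 2 φ ∧ Bdd φ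

/-- The quasilinear nonlocal operator `L = L₁ + L₂` acting on a (bounded `C²`)
function `φ`, where the jumps `j₁, j₂` depend on the gradient `Dφ(x)`. -/
def Lop {N P : ℕ} (μ₁ μ₂ : Measure (RE P)) (j₁ j₂ : RE N → RE P → RE N)
    (φ : RE N → ℝ) (x : RE N) : ℝ :=
  (∫ z, (φ (x + j₁ (gradient φ x) z) - φ x
      - ⟪j₁ (gradient φ x) z, gradient φ x⟫_ℝ) ∂μ₁)
  + ∫ z, (φ (x + j₂ (gradient φ x) z) - φ x) ∂μ₂

theorem continuous_ciInf_of_concaveOn_sub_sq {N : ℕ} {ι : Type*} [Nonempty ι]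
    {G : ι → RE N → ℝ} {c : ℝ}
    (hG : ∀ i, ConcaveOn ℝ Set.univ fun x => G i x - c * ‖x‖ ^ 2)
    (hb : ∀ x, BddBelow (Set.range fun i => G i x)) :
    Continuous fun x => ⨅ i, G i x := by
  have hconc : ConcaveOn ℝ Set.univ fun x => (⨅ i, G i x) - c * ‖x‖ ^ 2 := by
    refine ⟨convex_univ, fun x _ y _ a b ha hb' hab => ?_⟩
    rw [le_sub_iff_add_le]
    refine le_ciInf fun i => ?_
    have h1 := (hG i).2 (Set.mem_univ x) (Set.mem_univ y) ha hb' hab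
    have h2 := ciInf_le (hb x) i
    have h3 := ciInf_le (hb y) i
    simp only [smul_eq_mul] at h1 ⊢
    nlinarith [mul_le_mul_of_nonneg_left h2 ha, mul_le_mul_of_nonneg_left h3 hb']
  have hcont := continuousOn_univ.1 (hconc.continuousOn isOpen_univ)
  have h2 : Continuous fun x : RE N => c * ‖x‖ ^ 2 := by fun_prop
  exact (hcont.add h2).congr fun x => by simp

theorem exists_testFn_between {N : ℕ} {w W : RE N → ℝ} {C : ℝ} (hw : UpperSemicontinuous w)
    (hwb : Bdd w) (hW : Continuous W) (hwW : ∀ x, w x ≤ W x) (hWC : ∀ x, W x ≤ C)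
    {x₀ p : RE N} {c k : ℝ} (hWq : ∀ x, W x ≤ k + ⟪p, x - x₀⟫_ℝ + c * ‖x - x₀‖ ^ 2)
    {η r : ℝ} (hη : 0 < η) (hr : 0 < r) :
    ∃ φ : RE N → ℝ, TestFn φ ∧ (∀ x, w x ≤ φ x) ∧
      (∀ x, ‖x - x₀‖ < r / 2 → φ x = k + ⟪p, x - x₀⟫_ℝ + c * ‖x - x₀‖ ^ 2) ∧
      (∀ x, ‖x - x₀‖ < r →
        φ x ≤ k + ⟪p, x - x₀⟫_ℝ + c * ‖x - x₀‖ ^ 2 + η * min 1 (‖x - x₀‖ ^ 2)) ∧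
      (∀ x, r ≤ ‖x - x₀‖ → φ x ≤ W x + η * min 1 (‖x - x₀‖ ^ 2)) := by
  set q : RE N → ℝ := fun x => k + ⟪p, x - x₀⟫_ℝ + c * ‖x - x₀‖ ^ 2 with hq
  set g : RE N → ℝ := fun x => η * min 1 (‖x - x₀‖ ^ 2) with hg
  have hg0 : ∀ x, 0 ≤ g x := fun x => by positivity
  have hg1 : ∀ x, g x ≤ η := fun x => by
    have : min 1 (‖x - x₀‖ ^ 2) ≤ 1 := min_le_left _ _
    simp only [hg]; nlinarith
  have hgc : Continuous g := by simp only [hg]; fun_prop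
  have hqs : ContDiff ℝ 2 q := by
    simp only [hq]
    have : ContDiff ℝ 2 fun x : RE N => ‖x - x₀‖ ^ 2 := (contDiff_id.sub contDiff_const).norm_sq ℝ
    have h2 : ContDiff ℝ 2 fun x : RE N => ⟪p, x - x₀⟫_ℝ :=
      contDiff_const.inner ℝ (contDiff_id.sub contDiff_const)
    fun_prop
  let t : RE N → Set ℝ := fun x => {y | w x ≤ y ∧ (‖x - x₀‖ < r / 2 → y = q x) ∧
    (‖x - x₀‖ < r → y ≤ q x + g x) ∧ (r ≤ ‖x - x₀‖ → y ≤ W x + g x)}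
  have ht : ∀ x, Convex ℝ (t x) := by
    intro x y hy z hz a b ha hb hab
    simp only [t, Set.mem_ofPred_eq, smul_eq_mul] at hy hz ⊢
    obtain rfl : b = 1 - a := by linarith
    refine ⟨?_, fun h => ?_, fun h => ?_, fun h => ?_⟩
    · nlinarith [hy.1, hz.1]
    · rw [hy.2.1 h, hz.2.1 h]; ring
    · nlinarith [hy.2.2.1 h, hz.2.2.1 h]
    · nlinarith [hy.2.2.2 h, hz.2.2.2 h]
  have hloc : ∀ x : RE N, ∃ U ∈ 𝓝 x, ∃ s : RE N → ℝ,
      ContMDiffOn (modelWithCornersSelf ℝ (RE N)) (modelWithCornersSelf ℝ ℝ) 2 s U ∧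
        ∀ y ∈ U, s y ∈ t y := by
    intro x
    by_cases hx : ‖x - x₀‖ < r
    · refine ⟨ball x₀ r, isOpen_ball.mem_nhds (by simpa [dist_eq_norm] using hx), q,
        hqs.contMDiff.contMDiffOn, fun y hy => ?_⟩
      rw [mem_ball, dist_eq_norm] at hy
      exact ⟨(hwW y).trans (hWq y), fun _ => rfl, fun _ => by linarith [hg0 y],
        fun h => absurd h (not_le.2 hy)⟩
    · push Not at hx
      have hgx : 0 < g x := by
        have : 0 < ‖x - x₀‖ := hr.trans_le hx
        simp only [hg]; positivity
      obtain ⟨a, ha1, ha2⟩ := exists_between (show w x < W x + g x by linarith [hwW x])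
      have e1 : ∀ᶠ y in 𝓝 x, w y < a := hw x a ha1
      have e2 : ∀ᶠ y in 𝓝 x, a < W y + g y :=
        (hW.add hgc).continuousAt.eventually (lt_mem_nhds ha2)
      have e3 : ∀ᶠ y in 𝓝 x, r / 2 < ‖y - x₀‖ := by
        have : Continuous fun y : RE N => ‖y - x₀‖ := by fun_prop
        exact this.continuousAt.eventually (lt_mem_nhds (by linarith))
      refine ⟨_, (e1.and (e2.and e3)), fun _ => a, contMDiffOn_const, fun y hy => ?_⟩
      obtain ⟨h1, h2, h3⟩ := hy
      exact ⟨h1.le, fun h => absurd h (not_lt.2 h3.le), fun _ => by linarith [hWq y],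
        fun _ => h2.le⟩
  obtain ⟨φ, hφ⟩ := exists_contMDiffMap_forall_mem_convex_of_local
    (modelWithCornersSelf ℝ (RE N)) ht hloc
  refine ⟨φ, ⟨φ.contMDiff.contDiff, ?_⟩, fun x => (hφ x).1, fun x => (hφ x).2.1,
    fun x => (hφ x).2.2.1, fun x => (hφ x).2.2.2⟩
  obtain ⟨B, hB⟩ := hwb
  refine ⟨B + |C| + |k| + ‖p‖ * r + |c| * r ^ 2 + η, fun x => ?_⟩
  have hlow : -B ≤ φ x := (abs_le.1 (hB x)).1.trans (hφ x).1
  have hB0 : 0 ≤ B := (abs_nonneg _).trans (hB x)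
  have p1 : 0 ≤ ‖p‖ * r := by positivity
  have p2 : 0 ≤ |c| * r ^ 2 := by positivity
  have := hg1 x
  rw [abs_le]
  constructor
  · linarith [abs_nonneg C, abs_nonneg k]
  · rcases lt_or_ge ‖x - x₀‖ r with h | h
    · have h1 := (hφ x).2.2.1 h
      have h2 : ⟪p, x - x₀⟫_ℝ ≤ ‖p‖ * r :=
        (real_inner_le_norm _ _).trans (by gcongr)
      have h3 : c * ‖x - x₀‖ ^ 2 ≤ |c| * r ^ 2 := by
        gcongr
        exact le_abs_self c
      simp only [hq] at h1
      linarith [le_abs_self k, abs_nonneg C]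
    · have h1 := (hφ x).2.2.2 h
      linarith [le_abs_self C, hWC x, abs_nonneg k]

theorem hasGradientAt_quadratic {N : ℕ} (x₀ p : RE N) (c k : ℝ) :
    HasGradientAt (fun x => k + ⟪p, x - x₀⟫_ℝ + c * ‖x - x₀‖ ^ 2) p x₀ := by
  rw [hasGradientAt_iff_hasFDerivAt]
  have h0 : HasFDerivAt (fun x : RE N => x - x₀) (ContinuousLinearMap.id ℝ (RE N)) x₀ :=
    (hasFDerivAt_id x₀).sub_const x₀
  have h1 := ((hasFDerivAt_const p x₀).inner ℝ h0)
  have h2 := (h0.norm_sq).const_mul c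
  have h3 := (h1.const_add k).add h2
  refine h3.congr_fderiv ?_
  ext y
  simp [fderivInnerCLM_apply]

theorem exists_testFn_increment {N : ℕ} {w W : RE N → ℝ} {C : ℝ} (hw : UpperSemicontinuous w)
    (hwb : Bdd w) (hW : Continuous W) (hwW : ∀ x, w x ≤ W x) (hWC : ∀ x, W x ≤ C)
    {x₀ p : RE N} {c : ℝ} (hc : 0 ≤ c)
    (hWq : ∀ x, W x ≤ w x₀ + ⟪p, x - x₀⟫_ℝ + c * ‖x - x₀‖ ^ 2)
    {η : ℝ} (hη : 0 < η) (hη1 : η ≤ 1) :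
    ∃ φ : RE N → ℝ, TestFn φ ∧ (∀ x, w x ≤ φ x) ∧ gradient φ x₀ = p ∧ φ x₀ = w x₀ ∧
      (∀ a, φ (x₀ + a) ≤ |w x₀| + ‖p‖ + c + 1 + |C|) ∧
      (∃ K, ∀ a, |φ (x₀ + a) - w x₀ - ⟪a, p⟫_ℝ| ≤ K * ‖a‖ ^ 2) ∧
      (∀ a, φ (x₀ + a) ≤ w x₀ + ⟪a, p⟫_ℝ + (c + η) * ‖a‖ ^ 2) ∧
      (∀ a, (a = 0 ∨ η ≤ ‖a‖) → φ (x₀ + a) ≤ W (x₀ + a) + η * min 1 (‖a‖ ^ 2)) := by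
  obtain ⟨φ, hφ, hwφ, hnear, hball, hout⟩ := exists_testFn_between hw hwb hW hwW hWC hWq hη hη
  have hφx₀ : φ x₀ = w x₀ := by simpa using hnear x₀ (by simpa using hη)
  have hnear' : ∀ a, ‖a‖ < η / 2 → φ (x₀ + a) = w x₀ + ⟪a, p⟫_ℝ + c * ‖a‖ ^ 2 := fun a ha => by
    simpa [real_inner_comm] using hnear (x₀ + a) (by simpa using ha)
  have hball' : ∀ a, ‖a‖ < η →
      φ (x₀ + a) ≤ w x₀ + ⟪a, p⟫_ℝ + c * ‖a‖ ^ 2 + η * min 1 (‖a‖ ^ 2) := fun a ha => by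
    simpa [real_inner_comm] using hball (x₀ + a) (by simpa using ha)
  have hout' : ∀ a, η ≤ ‖a‖ → φ (x₀ + a) ≤ W (x₀ + a) + η * min 1 (‖a‖ ^ 2) := fun a ha => by
    simpa using hout (x₀ + a) (by simpa using ha)
  have hWq' : ∀ a, W (x₀ + a) ≤ w x₀ + ⟪a, p⟫_ℝ + c * ‖a‖ ^ 2 := fun a => by
    simpa [real_inner_comm] using hWq (x₀ + a)
  have hmin1 : ∀ a : RE N, η * min 1 (‖a‖ ^ 2) ≤ 1 := fun a =>
    mul_le_one₀ hη1 (by positivity) (min_le_left _ _)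
  have hmin2 : ∀ a : RE N, η * min 1 (‖a‖ ^ 2) ≤ η * ‖a‖ ^ 2 := fun a => by
    gcongr
    exact min_le_right _ _
  refine ⟨φ, hφ, hwφ, ?_, hφx₀, fun a => ?_, ?_, fun a => ?_, fun a ha => ?_⟩
  · have hev : φ =ᶠ[𝓝 x₀] fun x => w x₀ + ⟪p, x - x₀⟫_ℝ + c * ‖x - x₀‖ ^ 2 := by
      filter_upwards [ball_mem_nhds x₀ (half_pos hη)] with x hx
      exact hnear x (by simpa [dist_eq_norm] using hx)
    rw [hev.gradient_eq]
    exact (hasGradientAt_quadratic x₀ p c (w x₀)).gradient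
  · rcases lt_or_ge ‖a‖ η with h | h
    · have h1 := hball' a h
      have ha1 : ‖a‖ ≤ 1 := h.le.trans hη1
      have h2 : ⟪a, p⟫_ℝ ≤ ‖p‖ := (real_inner_le_norm _ _).trans
        (mul_le_of_le_one_left (norm_nonneg _) ha1)
      have h3 : c * ‖a‖ ^ 2 ≤ c := mul_le_of_le_one_right hc (pow_le_one₀ (norm_nonneg _) ha1)
      linarith [hmin1 a, le_abs_self (w x₀), abs_nonneg C]
    · linarith [hout' a h, hWC (x₀ + a), hmin1 a, le_abs_self C, abs_nonneg (w x₀),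
        norm_nonneg p]
  · obtain ⟨B, hB⟩ := hφ.2
    have hB0 : 0 ≤ B := (abs_nonneg _).trans (hB x₀)
    set R := (B + |w x₀|) * (2 / η) ^ 2 + ‖p‖ * (2 / η) with hR
    have hR0 : 0 ≤ R := by positivity
    refine ⟨c + R, fun a => ?_⟩
    rcases lt_or_ge ‖a‖ (η / 2) with h | h
    · rw [hnear' a h]
      have : w x₀ + ⟪a, p⟫_ℝ + c * ‖a‖ ^ 2 - w x₀ - ⟪a, p⟫_ℝ = c * ‖a‖ ^ 2 := by ring
      rw [this, abs_of_nonneg (by positivity)]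
      nlinarith [sq_nonneg ‖a‖]
    · have h1 : 1 ≤ 2 / η * ‖a‖ := by
        rw [div_mul_eq_mul_div, le_div_iff₀ hη]; linarith
      have h2 : |φ (x₀ + a) - w x₀ - ⟪a, p⟫_ℝ| ≤ B + |w x₀| + ‖a‖ * ‖p‖ := by
        refine (abs_sub _ _).trans (add_le_add ((abs_sub _ _).trans ?_)
          (abs_real_inner_le_norm _ _))
        exact add_le_add (hB _) le_rfl
      have h3 : B + |w x₀| ≤ (B + |w x₀|) * (2 / η * ‖a‖) ^ 2 :=
        le_mul_of_one_le_right (by positivity) (one_le_pow₀ h1)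
      have h4 : ‖a‖ * ‖p‖ ≤ ‖a‖ * ‖p‖ * (2 / η * ‖a‖) :=
        le_mul_of_one_le_right (by positivity) h1
      have h5 : 0 ≤ c * ‖a‖ ^ 2 := by positivity
      calc _ ≤ _ := h2
        _ ≤ (B + |w x₀|) * (2 / η * ‖a‖) ^ 2 + ‖a‖ * ‖p‖ * (2 / η * ‖a‖) := add_le_add h3 h4
        _ = R * ‖a‖ ^ 2 := by rw [hR]; ring
        _ ≤ (c + R) * ‖a‖ ^ 2 := by linarith
  · rcases lt_or_ge ‖a‖ η with h | h
    · linarith [hball' a h, hmin2 a]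
    · linarith [hout' a h, hmin2 a, hWq' a]
  · rcases ha with rfl | ha
    · simpa [hφx₀] using hwW x₀
    · exact hout' a ha

theorem concaveOn_norm_sub_sq_sub {N : ℕ} (α d : ℝ) (y : RE N) :
    ConcaveOn ℝ Set.univ fun x => α * ‖x - y‖ ^ 2 + d - α * ‖x‖ ^ 2 := by
  refine ⟨convex_univ, fun x _ x' _ a b _ _ hab => le_of_eq ?_⟩
  obtain rfl : b = 1 - a := by linarith
  simp only [norm_sub_sq_real, inner_add_left, real_inner_smul_left, smul_eq_mul]
  ring

theorem exists_continuous_between_doubling {N : ℕ} {u v : RE N → ℝ} {C α β M : ℝ}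
    (hu : ∀ x, |u x| ≤ C) (hv : ∀ x, |v x| ≤ C)
    (huv : ∀ x y, u x - v y ≤ α * ‖x - y‖ ^ 2 + β * ‖x‖ ^ 2 + M) :
    ∃ U V : RE N → ℝ, Continuous U ∧ Continuous V ∧ (∀ x, u x ≤ U x) ∧ (∀ y, -v y ≤ V y) ∧
      (∀ x, U x ≤ C) ∧ (∀ y, V y ≤ C) ∧
      ∀ x y, U x + V y ≤ α * ‖x - y‖ ^ 2 + β * ‖x‖ ^ 2 + M := by
  set Q : RE N → RE N → ℝ := fun x y => α * ‖x - y‖ ^ 2 + β * ‖x‖ ^ 2 + M with hQ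
  have hbU : ∀ x, BddBelow (Set.range fun y => Q x y + v y) := fun x => by
    refine ⟨u x, ?_⟩
    rintro _ ⟨y, rfl⟩
    simp only [hQ]
    linarith [huv x y]
  set U : RE N → ℝ := fun x => min C (⨅ y, Q x y + v y) with hU
  have hUc : Continuous U := by
    refine continuous_const.min (continuous_ciInf_of_concaveOn_sub_sq (c := α + β)
      (fun y => (concaveOn_norm_sub_sq_sub α (M + v y) y).congr fun x _ => ?_) hbU)
    simp only [hQ]
    ring
  have hUQ : ∀ x y, U x ≤ Q x y + v y := fun x y => (min_le_right _ _).trans (ciInf_le (hbU x) y)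
  have hbV : ∀ y, BddBelow (Set.range fun x => Q x y - U x) := fun y => by
    refine ⟨-v y, ?_⟩
    rintro _ ⟨x, rfl⟩
    simp only
    linarith [hUQ x y]
  set V : RE N → ℝ := fun y => min C (⨅ x, Q x y - U x) with hV
  have hVc : Continuous V := by
    refine continuous_const.min (continuous_ciInf_of_concaveOn_sub_sq (c := α)
      (fun x => (concaveOn_norm_sub_sq_sub α (β * ‖x‖ ^ 2 + M - U x) x).congr fun y _ => ?_) hbV)
    simp only [hQ, norm_sub_rev y x]
    ring
  refine ⟨U, V, hUc, hVc, fun x => le_min (abs_le.1 (hu x)).2 (le_ciInf fun y => ?_),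
    fun y => le_min (by linarith [(abs_le.1 (hv y)).1]) (le_ciInf fun x => ?_),
    fun x => min_le_left _ _, fun y => min_le_left _ _, fun x y => ?_⟩
  · linarith [huv x y]
  · linarith [hUQ x y]
  · have : V y ≤ Q x y - U x := (min_le_right _ _).trans (ciInf_le (hbV y) x)
    linarith

theorem tendsto_integral_indicator_small {N P : ℕ} {μ : Measure (RE P)} {a b : RE P → RE N}
    (ha : Measurable a) (hb : Measurable b) {h : RE P → ℝ} (hh : Integrable h μ) :
    Tendsto (fun n : ℕ => ∫ z, Set.indicator {z | ¬ ((a z = 0 ∨ 1 / ((n : ℝ) + 1) ≤ ‖a z‖) ∧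
      (b z = 0 ∨ 1 / ((n : ℝ) + 1) ≤ ‖b z‖))} h z ∂μ) atTop (𝓝 0) := by
  have hm : ∀ n : ℕ, MeasurableSet {z | ¬ ((a z = 0 ∨ 1 / ((n : ℝ) + 1) ≤ ‖a z‖) ∧
      (b z = 0 ∨ 1 / ((n : ℝ) + 1) ≤ ‖b z‖))} := fun n =>
    (((ha (measurableSet_singleton 0)).union (measurableSet_le measurable_const ha.norm)).inter
      ((hb (measurableSet_singleton 0)).union (measurableSet_le measurable_const hb.norm))).compl
  have key : ∀ c : RE N, ∀ᶠ n : ℕ in atTop, c = 0 ∨ 1 / ((n : ℝ) + 1) ≤ ‖c‖ := fun c => by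
    by_cases hc : c = 0
    · exact Eventually.of_forall fun _ => Or.inl hc
    · filter_upwards [tendsto_one_div_add_atTop_nhds_zero_nat.eventually
        (gt_mem_nhds (norm_pos_iff.2 hc))] with n hn
      exact Or.inr hn.le
  rw [← integral_zero (RE P) ℝ (μ := μ)]
  refine tendsto_integral_of_dominated_convergence (fun z => ‖h z‖)
    (fun n => hh.aestronglyMeasurable.indicator (hm n)) hh.norm
    (fun n => ae_of_all _ fun z => norm_indicator_le_norm_self _ _) (ae_of_all _ fun z => ?_)
  refine tendsto_const_nhds.congr' ?_
  filter_upwards [key (a z), key (b z)] with n h1 h2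
  rw [Set.indicator_of_notMem]
  exact not_not.2 ⟨h1, h2⟩

theorem integrable_norm_sq_of_lintegral_le {N P : ℕ} {μ : Measure (RE P)} {a : RE P → RE N}
    (ha : Measurable a) {C : ℝ}
    (h : (∫⁻ z, (‖a z‖₊ : ℝ≥0∞) ^ 2 ∂μ) ≤ ENNReal.ofReal C) :
    Integrable (fun z => ‖a z‖ ^ 2) μ := by
  refine ⟨(ha.norm.pow_const 2).aestronglyMeasurable, ?_⟩
  rw [HasFiniteIntegral]
  refine lt_of_le_of_lt (le_of_eq (lintegral_congr fun z => ?_)) (h.trans_lt ENNReal.ofReal_lt_top)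
  simp [enorm_eq_nnnorm]

theorem integral_norm_sq_le_of_lintegral_le {N P : ℕ} {μ : Measure (RE P)} {a : RE P → RE N}
    (ha : Measurable a) {C : ℝ} (hC : 0 ≤ C)
    (h : (∫⁻ z, (‖a z‖₊ : ℝ≥0∞) ^ 2 ∂μ) ≤ ENNReal.ofReal C) :
    ∫ z, ‖a z‖ ^ 2 ∂μ ≤ C := by
  rw [integral_eq_lintegral_of_nonneg_ae (ae_of_all _ fun z => by positivity)
    (ha.norm.pow_const 2).aestronglyMeasurable]
  refine ENNReal.toReal_le_of_le_ofReal hC (le_trans (le_of_eq (lintegral_congr fun z => ?_)) h)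
  rw [ENNReal.ofReal_pow (norm_nonneg _), ofReal_norm, enorm_eq_nnnorm]

theorem doubling_inequality {N P : ℕ} {μ₁ μ₂ : Measure (RE P)} [IsFiniteMeasure μ₂]
    {j₁ j₂ : RE N → RE P → RE N} {f u v : RE N → ℝ} {C α β : ℝ}
    (hj₁m : ∀ p, Measurable (j₁ p)) (hj₂m : ∀ p, Measurable (j₂ p))
    (hj₁i : ∀ p, Integrable (fun z => ‖j₁ p z‖ ^ 2) μ₁)
    (hα : 0 ≤ α) (hβ : 0 ≤ β)
    (hu : ∀ x, |u x| ≤ C) (husc : UpperSemicontinuous u)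
    (hsub : ∀ φ : RE N → ℝ, TestFn φ → ∀ x : RE N, (∀ y, u y - φ y ≤ u x - φ x) →
      -(Lop μ₁ μ₂ j₁ j₂ φ x) + u x ≤ f x)
    (hv : ∀ x, |v x| ≤ C) (hlsc : LowerSemicontinuous v)
    (hsuper : ∀ φ : RE N → ℝ, TestFn φ → ∀ x : RE N, (∀ y, v x - φ x ≤ v y - φ y) →
      f x ≤ -(Lop μ₁ μ₂ j₁ j₂ φ x) + v x)
    {x₀ y₀ : RE N}
    (hmax : ∀ x y, u x - v y - (α * ‖x - y‖ ^ 2 + β * ‖x‖ ^ 2) ≤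
      u x₀ - v y₀ - (α * ‖x₀ - y₀‖ ^ 2 + β * ‖x₀‖ ^ 2))
    {p s : RE N} (hs : s = (2 * α) • (x₀ - y₀)) (hp : p = s + (2 * β) • x₀) :
    u x₀ - v y₀ ≤ f x₀ - f y₀ +
      ∫ z, (α * ‖j₁ p z - j₁ s z‖ ^ 2 + β * ‖j₁ p z‖ ^ 2) ∂μ₁ +
      ∫ z, min (4 * C) |α * (2 * ⟪x₀ - y₀, j₂ p z - j₂ s z⟫_ℝ + ‖j₂ p z - j₂ s z‖ ^ 2) +
        β * (2 * ⟪x₀, j₂ p z⟫_ℝ + ‖j₂ p z‖ ^ 2)| ∂μ₂ := by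
  have hC0 : 0 ≤ C := (abs_nonneg _).trans (hu x₀)
  obtain ⟨U, V, hUc, hVc, huU, hvV, hUC, hVC, hUV⟩ := exists_continuous_between_doubling
    (α := α) (β := β) (M := u x₀ - v y₀ - (α * ‖x₀ - y₀‖ ^ 2 + β * ‖x₀‖ ^ 2)) hu hv
    (fun x y => by linarith [hmax x y])
  have hQ : ∀ a b : RE N, U (x₀ + a) + V (y₀ + b) ≤ u x₀ - v y₀ + ⟪a, p⟫_ℝ - ⟪b, s⟫_ℝ +
      (α * ‖a - b‖ ^ 2 + β * ‖a‖ ^ 2) := fun a b => by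
    have h1 := hUV (x₀ + a) (y₀ + b)
    have h2 : x₀ + a - (y₀ + b) = (x₀ - y₀) + (a - b) := by abel
    rw [h2, norm_add_sq_real, norm_add_sq_real] at h1
    rw [hp, hs, inner_add_right, real_inner_smul_right, real_inner_smul_right,
      real_inner_smul_right]
    rw [inner_sub_right, real_inner_comm a, real_inner_comm b, real_inner_comm a x₀] at h1
    linarith
  have hUx₀ : u x₀ ≤ U x₀ := huU x₀
  have hVy₀ : -v y₀ ≤ V y₀ := hvV y₀
  have hUq : ∀ x, U x ≤ u x₀ + ⟪p, x - x₀⟫_ℝ + (α + β) * ‖x - x₀‖ ^ 2 := fun x => by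
    have := hQ (x - x₀) 0
    simp only [add_sub_cancel, add_zero, inner_zero_left, sub_zero] at this
    rw [real_inner_comm]
    linarith
  have hVq : ∀ y, V y ≤ -v y₀ + ⟪-s, y - y₀⟫_ℝ + α * ‖y - y₀‖ ^ 2 := fun y => by
    have := hQ 0 (y - y₀)
    simp only [add_sub_cancel, add_zero, inner_zero_left, zero_sub, norm_neg, norm_zero] at this
    rw [inner_neg_left, real_inner_comm]
    linarith
  set A : ℕ → Set (RE P) := fun n => {z | ¬ ((j₁ p z = 0 ∨ 1 / ((n : ℝ) + 1) ≤ ‖j₁ p z‖) ∧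
      (j₁ s z = 0 ∨ 1 / ((n : ℝ) + 1) ≤ ‖j₁ s z‖))} with hA
  set A' : ℕ → Set (RE P) := fun n => {z | ¬ ((j₂ p z = 0 ∨ 1 / ((n : ℝ) + 1) ≤ ‖j₂ p z‖) ∧
      (j₂ s z = 0 ∨ 1 / ((n : ℝ) + 1) ≤ ‖j₂ s z‖))} with hA'
  have hAm : ∀ n, MeasurableSet (A n) := fun n =>
    ((((hj₁m p) (measurableSet_singleton 0)).union
      (measurableSet_le measurable_const (hj₁m p).norm)).inter
      (((hj₁m s) (measurableSet_singleton 0)).union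
        (measurableSet_le measurable_const (hj₁m s).norm))).compl
  have hAm' : ∀ n, MeasurableSet (A' n) := fun n =>
    ((((hj₂m p) (measurableSet_singleton 0)).union
      (measurableSet_le measurable_const (hj₂m p).norm)).inter
      (((hj₂m s) (measurableSet_singleton 0)).union
        (measurableSet_le measurable_const (hj₂m s).norm))).compl
  set S : RE P → ℝ := fun z => ‖j₁ p z‖ ^ 2 + ‖j₁ s z‖ ^ 2 with hS
  have hSi : Integrable S μ₁ := (hj₁i p).add (hj₁i s)
  set B : RE P → ℝ := fun z => α * ‖j₁ p z - j₁ s z‖ ^ 2 + β * ‖j₁ p z‖ ^ 2 with hB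
  have hBi : Integrable B μ₁ := by
    refine Integrable.add (Integrable.const_mul ?_ α) ((hj₁i p).const_mul β)
    refine (hSi.const_mul 2).mono' (((hj₁m p).sub (hj₁m s)).norm.pow_const 2).aestronglyMeasurable
      (ae_of_all _ fun z => ?_)
    have h1 := norm_sub_le (j₁ p z) (j₁ s z)
    have h2 : ‖j₁ p z - j₁ s z‖ ^ 2 ≤ (‖j₁ p z‖ + ‖j₁ s z‖) ^ 2 := by gcongr
    rw [Real.norm_of_nonneg (by positivity)]
    simp only [hS]
    nlinarith [sq_nonneg (‖j₁ p z‖ - ‖j₁ s z‖)]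
  set D : RE P → ℝ := fun z => min (4 * C)
    |α * (2 * ⟪x₀ - y₀, j₂ p z - j₂ s z⟫_ℝ + ‖j₂ p z - j₂ s z‖ ^ 2) +
        β * (2 * ⟪x₀, j₂ p z⟫_ℝ + ‖j₂ p z‖ ^ 2)| with hD
  have hDm : Measurable D := by
    have := hj₂m p
    have := hj₂m s
    simp only [hD]
    fun_prop
  have hD0 : ∀ z, 0 ≤ D z := fun z => by positivity
  have hDi : Integrable D μ₂ := Integrable.of_bound hDm.aestronglyMeasurable (4 * C)
    (ae_of_all _ fun z => by rw [Real.norm_of_nonneg (hD0 z)]; exact min_le_left _ _)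
  set K : ℝ := (|u x₀| + ‖p‖ + (α + β) + 1 + |C| - u x₀) +
    (|-v y₀| + ‖-s‖ + α + 1 + |C| - (-v y₀)) with hK
  set R : ℕ → ℝ := fun n => f x₀ - f y₀ + (∫ z, B z ∂μ₁ +
      (1 / ((n : ℝ) + 1)) * ∫ z, S z ∂μ₁ +
      ∫ z, (A n).indicator (fun z => (α + β) * S z) z ∂μ₁) +
      (∫ z, D z ∂μ₂ + (1 / ((n : ℝ) + 1)) * (2 * μ₂.real Set.univ) +
        ∫ z, (A' n).indicator (fun _ => K) z ∂μ₂) with hR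
  have hlim : Tendsto R atTop (𝓝 (f x₀ - f y₀ + (∫ z, B z ∂μ₁ + 0 * ∫ z, S z ∂μ₁ + 0) +
      (∫ z, D z ∂μ₂ + 0 * (2 * μ₂.real Set.univ) + 0))) := by
    have t0 := tendsto_one_div_add_atTop_nhds_zero_nat (𝕜 := ℝ)
    refine (tendsto_const_nhds.add ((tendsto_const_nhds.add (t0.mul_const _)).add
      (tendsto_integral_indicator_small (hj₁m p) (hj₁m s) (hSi.const_mul _)))).add
      ((tendsto_const_nhds.add (t0.mul_const _)).add
      (tendsto_integral_indicator_small (hj₂m p) (hj₂m s) (integrable_const K)))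
  have hle : ∀ n, u x₀ - v y₀ ≤ R n := fun n => by
    set η : ℝ := 1 / ((n : ℝ) + 1) with hη_def
    have hη : 0 < η := by positivity
    have hη1 : η ≤ 1 := by
      rw [hη_def, div_le_one (by positivity)]
      linarith [(Nat.cast_nonneg n : (0 : ℝ) ≤ n)]
    obtain ⟨φ, hφ, huφ, hgφ, hφ₀, hφK, ⟨K₁, hK₁⟩, hφq, hφU⟩ :=
      exists_testFn_increment husc ⟨C, hu⟩ hUc huU hUC (add_nonneg hα hβ) hUq hη hη1
    obtain ⟨ψ, hψ, hvψ, hgψ, hψ₀, hψK, ⟨K₂, hK₂⟩, hψq, hψV⟩ :=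
      exists_testFn_increment (w := fun y => -v y) (fun y c hc => by
        filter_upwards [hlsc y (-c) (by linarith)] with z hz
        linarith) ⟨C, fun y => by rw [abs_neg]; exact hv y⟩ hVc hvV hVC hα hVq hη hη1
    have hφc := hφ.1.continuous
    have hψc := hψ.1.continuous
    have e1 := hsub φ hφ x₀ fun y => by linarith [huφ y]
    have e2 := hsuper (fun y => -ψ y) ⟨hψ.1.neg, by
      obtain ⟨B, hB⟩ := hψ.2
      exact ⟨B, fun y => by rw [abs_neg]; exact hB y⟩⟩ y₀ fun y => by linarith [hvψ y]
    have hgψ' : gradient (fun y => -ψ y) y₀ = s := by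
      have h := (hψ.1.differentiable (by norm_num) y₀).hasGradientAt
      rw [hgψ] at h
      have := h.hasFDerivAt.neg
      rw [← map_neg, neg_neg] at this
      exact (hasGradientAt_iff_hasFDerivAt.2 this).gradient
    rw [Lop, hgφ, hφ₀] at e1
    rw [Lop, hgψ', hψ₀] at e2
    set F₁ : RE P → ℝ := fun z => φ (x₀ + j₁ p z) - u x₀ - ⟪j₁ p z, p⟫_ℝ with hF₁
    set F₂ : RE P → ℝ := fun z => φ (x₀ + j₂ p z) - u x₀ with hF₂
    set G₁ : RE P → ℝ := fun z => -ψ (y₀ + j₁ s z) - -(-v y₀) - ⟪j₁ s z, s⟫_ℝ with hG₁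
    set G₂ : RE P → ℝ := fun z => -ψ (y₀ + j₂ s z) - -(-v y₀) with hG₂
    have m1 := hj₁m p
    have m2 := hj₁m s
    have m3 := hj₂m p
    have m4 := hj₂m s
    have iF₁ : Integrable F₁ μ₁ := ((hj₁i p).const_mul K₁).mono'
      (by simp only [hF₁]; fun_prop) (ae_of_all _ fun z => hK₁ _)
    have iG₁ : Integrable G₁ μ₁ := ((hj₁i s).const_mul K₂).mono'
      (by simp only [hG₁]; fun_prop) (ae_of_all _ fun z => by
        have := hK₂ (j₁ s z)
        rw [inner_neg_right, ← abs_neg] at this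
        refine le_trans (le_of_eq ?_) this
        rw [Real.norm_eq_abs]
        congr 1
        simp only [hG₁]
        ring)
    have iF₂ : Integrable F₂ μ₂ := by
      obtain ⟨B, hB⟩ := hφ.2
      exact (Integrable.of_bound (by fun_prop) B (ae_of_all _ fun z => hB _)).sub
        (integrable_const _)
    have iG₂ : Integrable G₂ μ₂ := by
      obtain ⟨B, hB⟩ := hψ.2
      exact (Integrable.of_bound (by fun_prop) B (ae_of_all _ fun z => hB _)).neg.sub
        (integrable_const _)
    have I₁ : ∫ z, F₁ z ∂μ₁ - ∫ z, G₁ z ∂μ₁ ≤ ∫ z, B z ∂μ₁ + η * ∫ z, S z ∂μ₁ +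
        ∫ z, (A n).indicator (fun z => (α + β) * S z) z ∂μ₁ := by
      have iI := (hSi.const_mul (α + β)).indicator (hAm n)
      have iBS : Integrable (fun z => B z + η * S z) μ₁ := hBi.add (hSi.const_mul η)
      rw [← integral_sub iF₁ iG₁, ← integral_const_mul, ← integral_add hBi (hSi.const_mul η),
        ← integral_add iBS iI]
      refine integral_mono (iF₁.sub iG₁) (iBS.add iI) fun z => ?_
      by_cases hz : z ∈ A n
      · have h1 := hφq (j₁ p z)
        have h2 := hψq (j₁ s z)
        rw [inner_neg_right] at h2
        have h3 : 0 ≤ B z := by positivity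
        have h4 : 0 ≤ β * ‖j₁ s z‖ ^ 2 := by positivity
        simp only [Set.indicator_of_mem hz, hS, hF₁, hG₁]
        linarith
      · have hz' := not_not.1 hz
        have h1 := hφU _ hz'.1
        have h2 := hψV _ hz'.2
        have h3 := hQ (j₁ p z) (j₁ s z)
        have h4 : η * min 1 (‖j₁ p z‖ ^ 2) ≤ η * ‖j₁ p z‖ ^ 2 := by
          gcongr
          exact min_le_right _ _
        have h5 : η * min 1 (‖j₁ s z‖ ^ 2) ≤ η * ‖j₁ s z‖ ^ 2 := by
          gcongr
          exact min_le_right _ _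
        simp only [Set.indicator_of_notMem hz, hS, hF₁, hG₁, hB]
        linarith
    have I₂ : ∫ z, F₂ z ∂μ₂ - ∫ z, G₂ z ∂μ₂ ≤ ∫ z, D z ∂μ₂ + η * (2 * μ₂.real Set.univ) +
        ∫ z, (A' n).indicator (fun _ => K) z ∂μ₂ := by
      have iI := (integrable_const (μ := μ₂) K).indicator (hAm' n)
      have ic := integrable_const (μ := μ₂) (η * 2)
      have iDc : Integrable (fun z => D z + η * 2) μ₂ := hDi.add ic
      have : η * (2 * μ₂.real Set.univ) = ∫ _, η * 2 ∂μ₂ := by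
        rw [integral_const, smul_eq_mul]; ring
      rw [← integral_sub iF₂ iG₂, this, ← integral_add hDi ic, ← integral_add iDc iI]
      refine integral_mono (iF₂.sub iG₂) (iDc.add iI) fun z => ?_
      by_cases hz : z ∈ A' n
      · have h1 := hφK (j₂ p z)
        have h2 := hψK (j₂ s z)
        have h3 := hD0 z
        simp only [Set.indicator_of_mem hz, hK, hF₂, hG₂]
        linarith
      · have hz' := not_not.1 hz
        have h1 := hφU _ hz'.1
        have h2 := hψV _ hz'.2
        have h4 : η * min 1 (‖j₂ p z‖ ^ 2) ≤ η :=
          mul_le_of_le_one_right hη.le (min_le_left _ _)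
        have h5 : η * min 1 (‖j₂ s z‖ ^ 2) ≤ η :=
          mul_le_of_le_one_right hη.le (min_le_left _ _)
        have h6 : U (x₀ + j₂ p z) - u x₀ + (V (y₀ + j₂ s z) + v y₀) ≤ D z := by
          refine le_min ?_ (le_trans ?_ (le_abs_self _))
          · linarith [hUC (x₀ + j₂ p z), hVC (y₀ + j₂ s z), (abs_le.1 (hu x₀)).1,
              (abs_le.1 (hv y₀)).2]
          · have h3 := hQ (j₂ p z) (j₂ s z)
            rw [hp, hs, inner_add_right, real_inner_smul_right, real_inner_smul_right,
              real_inner_smul_right] at h3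
            rw [inner_sub_right, ← real_inner_comm x₀]
            rw [← hs, ← hp] at h3
            rw [real_inner_comm _ (x₀ - y₀), real_inner_comm _ (x₀ - y₀)]
            linarith
        simp only [Set.indicator_of_notMem hz, hF₂, hG₂]
        linarith
    simp only [hR]
    linarith
  refine (ge_of_tendsto' hlim hle).trans (le_of_eq ?_)
  ring

theorem exists_max_doubling {N : ℕ} {u v : RE N → ℝ} {C α β : ℝ}
    (hu : ∀ x, |u x| ≤ C) (husc : UpperSemicontinuous u)
    (hv : ∀ x, |v x| ≤ C) (hlsc : LowerSemicontinuous v) (hα : 0 < α) (hβ : 0 < β) :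
    ∃ x₀ y₀, ∀ x y, u x - v y - (α * ‖x - y‖ ^ 2 + β * ‖x‖ ^ 2) ≤
      u x₀ - v y₀ - (α * ‖x₀ - y₀‖ ^ 2 + β * ‖x₀‖ ^ 2) := by
  have hC0 : 0 ≤ C := (abs_nonneg _).trans (hu 0)
  set Φ : RE N × RE N → ℝ := fun z => u z.1 + -v z.2 +
    -(α * ‖z.1 - z.2‖ ^ 2 + β * ‖z.1‖ ^ 2) with hΦ
  have husc' : UpperSemicontinuous Φ := by
    refine UpperSemicontinuous.add (UpperSemicontinuous.add ?_ ?_)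
      (Continuous.upperSemicontinuous (by fun_prop))
    · exact husc.comp continuous_fst
    · intro z c hc
      have h := continuous_snd.continuousAt.eventually (hlsc z.2 (-c) (by linarith))
      filter_upwards [h] with w hw
      linarith
  set R := 4 * C / α + 4 * C / β + 1 with hR
  have hR1 : 1 ≤ R := by
    have : 0 ≤ 4 * C / α + 4 * C / β := by positivity
    linarith
  have hbig : ∀ γ : ℝ, 0 < γ → 4 * C / γ ≤ R → ∀ t : ℝ, R < t → 4 * C < γ * t ^ 2 := by
    intro γ hγ hγR t ht
    have h1 : 4 * C ≤ R * γ := (div_le_iff₀ hγ).1 hγR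
    have h2 : R < t ^ 2 := by nlinarith
    nlinarith
  have hαR := hbig α hα (by
    have : 0 ≤ 4 * C / β := by positivity
    linarith)
  have hβR := hbig β hβ (by
    have : 0 ≤ 4 * C / α := by positivity
    linarith)
  obtain ⟨⟨x₀, y₀⟩, -, hmax⟩ := (husc'.upperSemicontinuousOn _).exists_isMaxOn
    (s := closedBall 0 R ×ˢ closedBall 0 (2 * R))
    ⟨(0, 0), by simp; linarith⟩ ((isCompact_closedBall _ _).prod (isCompact_closedBall _ _))
  have h0 : u 0 - v 0 ≤ Φ (x₀, y₀) := by
    have := hmax (a := (0, 0)) (by simp; linarith)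
    simpa [hΦ, sub_eq_add_neg] using this
  refine ⟨x₀, y₀, fun x y => ?_⟩
  have hgoal : Φ (x, y) ≤ Φ (x₀, y₀) := by
    by_cases hxy : ‖x‖ ≤ R ∧ ‖y‖ ≤ 2 * R
    · exact hmax (a := (x, y)) (by simpa using hxy)
    · refine le_trans ?_ h0
      have h1 : 4 * C < α * ‖x - y‖ ^ 2 + β * ‖x‖ ^ 2 := by
        have p1 : 0 ≤ α * ‖x - y‖ ^ 2 := by positivity
        have p2 : 0 ≤ β * ‖x‖ ^ 2 := by positivity
        by_cases hx : ‖x‖ ≤ R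
        · have hy : 2 * R < ‖y‖ := by
            by_contra h
            exact hxy ⟨hx, not_lt.1 h⟩
          have h2 := norm_sub_norm_le y x
          rw [norm_sub_rev] at h2
          linarith [hαR ‖x - y‖ (by linarith)]
        · linarith [hβR ‖x‖ (not_le.1 hx)]
      simp only [hΦ]
      linarith [(abs_le.1 (hu x)).2, (abs_le.1 (hv y)).1, (abs_le.1 (hu 0)).1, (abs_le.1 (hv 0)).2]
  simpa [hΦ, sub_eq_add_neg] using hgoal

theorem tendsto_integral_norm_sub_sq_of_modulus {N P : ℕ} {μ : Measure (RE P)}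
    {j : RE N → RE P → RE N} (hjm : ∀ p, Measurable (j p)) {r : ℝ} {ω : ℝ → ℝ}
    (hω : IsModulus ω)
    (hj : ∀ p q : RE N, ‖p‖ < r → ‖q‖ < r →
      (∫⁻ z, (‖j p z - j q z‖₊ : ℝ≥0∞) ^ 2 ∂μ) ≤ ENNReal.ofReal (ω ‖p - q‖))
    {p s : ℕ → RE N} (hp : ∀ n, ‖p n‖ < r) (hs : ∀ n, ‖s n‖ < r)
    (hps : Tendsto (fun n => ‖p n - s n‖) atTop (𝓝 0)) :
    Tendsto (fun n => ∫ z, ‖j (p n) z - j (s n) z‖ ^ 2 ∂μ) atTop (𝓝 0) := by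
  have h0 : ∀ n, 0 ≤ ∫ z, ‖j (p n) z - j (s n) z‖ ^ 2 ∂μ := fun n =>
    integral_nonneg fun z => by positivity
  rw [Metric.tendsto_atTop]
  intro e he
  have h1 := hω.2.2.eventually (gt_mem_nhds he)
  rw [eventually_nhdsWithin_iff, Metric.eventually_nhds_iff] at h1
  obtain ⟨d, hd, hωd⟩ := h1
  obtain ⟨n₀, hn₀⟩ := Metric.tendsto_atTop.1 hps d hd
  refine ⟨n₀, fun n hn => ?_⟩
  rw [Real.dist_0_eq_abs, abs_of_nonneg (h0 n)]
  rcases (norm_nonneg (p n - s n)).eq_or_lt with h | h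
  · have : p n = s n := sub_eq_zero.1 (norm_eq_zero.1 h.symm)
    simpa [this] using he
  · exact (integral_norm_sq_le_of_lintegral_le ((hjm _).sub (hjm _)) (hω.1 _)
      (hj _ _ (hp n) (hs n))).trans_lt (hωd (hn₀ n hn) h)

theorem tendsto_integral_min_jump {N P : ℕ} {μ : Measure (RE P)} [IsFiniteMeasure μ]
    {j : RE N → RE P → RE N} (hjm : ∀ p, Measurable (j p))
    (hjc : ∀ᵐ z ∂μ, Continuous fun p => j p z) {r K α δ : ℝ} (hK : 0 ≤ K) (hα : 0 ≤ α)
    {p s d x : ℕ → RE N} {β : ℕ → ℝ} (hβ0 : ∀ n, 0 ≤ β n)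
    (hp : ∀ n, ‖p n‖ < r) (hs : ∀ n, ‖s n‖ < r)
    (hps : Tendsto (fun n => ‖p n - s n‖) atTop (𝓝 0)) (hd : ∀ n, ‖d n‖ ≤ δ)
    (hβ : Tendsto β atTop (𝓝 0)) (hβx : Tendsto (fun n => β n * ‖x n‖) atTop (𝓝 0)) :
    Tendsto (fun n => ∫ z, min K
      |α * (2 * ⟪d n, j (p n) z - j (s n) z⟫_ℝ + ‖j (p n) z - j (s n) z‖ ^ 2) +
        β n * (2 * ⟪x n, j (p n) z⟫_ℝ + ‖j (p n) z‖ ^ 2)| ∂μ) atTop (𝓝 0) := by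
  rw [← integral_zero (RE P) ℝ (μ := μ)]
  refine tendsto_integral_of_dominated_convergence (fun _ => K) (fun n => ?_)
    (integrable_const K) (fun n => ae_of_all _ fun z => ?_) ?_
  · have := hjm (p n)
    have := hjm (s n)
    exact Measurable.aestronglyMeasurable (by fun_prop)
  · rw [Real.norm_of_nonneg (by positivity)]
    exact min_le_left _ _
  filter_upwards [hjc] with z hz
  obtain ⟨B, hB⟩ := (isCompact_closedBall (0 : RE N) r).exists_bound_of_continuousOn
    hz.continuousOn
  have hB' : ∀ n, ‖j (p n) z‖ ≤ B := fun n => hB _ (by simpa using (hp n).le)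
  have hB0 : 0 ≤ B := (norm_nonneg _).trans (hB' 0)
  have he : Tendsto (fun n => ‖j (p n) z - j (s n) z‖) atTop (𝓝 0) := by
    have huc := (isCompact_closedBall (0 : RE N) r).uniformContinuousOn_of_continuous
      hz.continuousOn
    rw [Metric.uniformContinuousOn_iff] at huc
    rw [Metric.tendsto_atTop]
    intro e he
    obtain ⟨t, ht, h⟩ := huc e he
    obtain ⟨n₀, hn₀⟩ := Metric.tendsto_atTop.1 hps t ht
    refine ⟨n₀, fun n hn => ?_⟩
    have h1 := hn₀ n hn
    rw [Real.dist_0_eq_abs, abs_norm] at h1 ⊢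
    rw [← dist_eq_norm] at h1 ⊢
    exact h _ (by simpa using (hp n).le) _ (by simpa using (hs n).le) h1
  have hlim : Tendsto (fun n => α * (2 * (δ * ‖j (p n) z - j (s n) z‖) +
      ‖j (p n) z - j (s n) z‖ ^ 2) + (2 * (β n * ‖x n‖ * B) + β n * B ^ 2)) atTop (𝓝 0) := by
    have := ((((he.const_mul δ).const_mul 2).add (he.pow 2)).const_mul α).add
      (((hβx.mul_const B).const_mul 2).add (hβ.mul_const (B ^ 2)))
    simpa using this
  refine squeeze_zero (fun n => by positivity) (fun n => (min_le_right _ _).trans ?_) hlim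
  have h1 : |⟪d n, j (p n) z - j (s n) z⟫_ℝ| ≤ δ * ‖j (p n) z - j (s n) z‖ :=
    (abs_real_inner_le_norm _ _).trans (by gcongr; exact hd n)
  have h2 : |⟪x n, j (p n) z⟫_ℝ| ≤ ‖x n‖ * B :=
    (abs_real_inner_le_norm _ _).trans (by gcongr; exact hB' n)
  have h3 : ‖j (p n) z‖ ^ 2 ≤ B ^ 2 := by gcongr; exact hB' n
  refine (abs_add_le _ _).trans (add_le_add ?_ ?_)
  · rw [abs_mul, abs_of_nonneg hα]
    gcongr
    refine (abs_add_le _ _).trans ?_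
    rw [abs_mul, abs_two, abs_of_nonneg (sq_nonneg ‖_‖)]
    gcongr
  · rw [abs_mul, abs_of_nonneg (hβ0 n)]
    have h4 : |2 * ⟪x n, j (p n) z⟫_ℝ + ‖j (p n) z‖ ^ 2| ≤ 2 * (‖x n‖ * B) + B ^ 2 := by
      refine (abs_add_le _ _).trans ?_
      rw [abs_mul, abs_two, abs_of_nonneg (sq_nonneg ‖_‖)]
      gcongr
    calc _ ≤ β n * (2 * (‖x n‖ * B) + B ^ 2) := mul_le_mul_of_nonneg_left h4 (hβ0 n)
      _ = _ := by ring

/-- Comparison principle for the quasilinear equation `-L[u,Du] + u = f` in `ℝ^N`. -/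
theorem comparison_quasilinear
    (N P : ℕ) (hN : 1 ≤ N) (hP : 1 ≤ P)
    (μ₁ μ₂ : Measure (RE P)) (j₁ j₂ : RE N → RE P → RE N)
    (f u v : RE N → ℝ)
    -- (M): nonnegative measures on ℝ^P ∖ {0} with ∫ |z|² dμ₁ + ∫ dμ₂ < ∞
    (hM0 : μ₁ {0} = 0) (hM0' : μ₂ {0} = 0)
    (hM1 : (∫⁻ z, (‖z‖₊ : ℝ≥0∞) ^ 2 ∂μ₁) < ⊤)
    (hM2 : μ₂ Set.univ < ⊤)
    -- j measurable and continuous in p for a.e. z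
    (hj₁m : Measurable (Function.uncurry j₁))
    (hj₂m : Measurable (Function.uncurry j₂))
    (hj₁c : ∀ᵐ z ∂μ₁, Continuous fun p => j₁ p z)
    (hj₂c : ∀ᵐ z ∂μ₂, Continuous fun p => j₂ p z)
    -- (J1)
    (hJ1 : ∀ r > 0, ∃ C > 0, ∀ p : RE N, ‖p‖ < r →
      (∫⁻ z, (‖j₁ p z‖₊ : ℝ≥0∞) ^ 2 ∂μ₁) ≤ ENNReal.ofReal C)
    -- (J2)
    (hJ2 : ∀ r > 0, ∃ ω : ℝ → ℝ, IsModulus ω ∧ ∀ p q : RE N, ‖p‖ < r → ‖q‖ < r →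
      (∫⁻ z, (‖j₁ p z - j₁ q z‖₊ : ℝ≥0∞) ^ 2 ∂μ₁) ≤ ENNReal.ofReal (ω ‖p - q‖))
    -- (F4)
    (hf : UniformContinuous f)
    -- u : bounded usc viscosity subsolution of -L[u,Du] + u = f
    (hub : Bdd u) (husc : UpperSemicontinuous u)
    (hsub : ∀ φ : RE N → ℝ, TestFn φ → ∀ x : RE N, (∀ y, u y - φ y ≤ u x - φ x) →
      -(Lop μ₁ μ₂ j₁ j₂ φ x) + u x ≤ f x)
    -- v : bounded lsc viscosity supersolution of -L[v,Dv] + v = f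
    (hvb : Bdd v) (hlsc : LowerSemicontinuous v)
    (hsuper : ∀ φ : RE N → ℝ, TestFn φ → ∀ x : RE N, (∀ y, v x - φ x ≤ v y - φ y) →
      f x ≤ -(Lop μ₁ μ₂ j₁ j₂ φ x) + v x) :
    ∀ x, u x ≤ v x := by
  have : IsFiniteMeasure μ₂ := ⟨hM2⟩
  have hm₁ : ∀ p, Measurable (j₁ p) := fun p => hj₁m.of_uncurry_left
  have hm₂ : ∀ p, Measurable (j₂ p) := fun p => hj₂m.of_uncurry_left
  have hj₁i : ∀ p, Integrable (fun z => ‖j₁ p z‖ ^ 2) μ₁ := fun p => by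
    obtain ⟨B, -, hB⟩ := hJ1 (‖p‖ + 1) (by positivity)
    exact integrable_norm_sq_of_lintegral_le (hm₁ p) (hB p (by linarith))
  obtain ⟨Cu, hCu⟩ := hub
  obtain ⟨Cv, hCv⟩ := hvb
  set C := max Cu Cv with hC
  have hu : ∀ x, |u x| ≤ C := fun x => (hCu x).trans (le_max_left _ _)
  have hv : ∀ x, |v x| ≤ C := fun x => (hCv x).trans (le_max_right _ _)
  have hC0 : 0 ≤ C := (abs_nonneg _).trans (hu 0)
  intro z₀
  refine le_of_forall_pos_le_add fun ε hε => ?_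
  obtain ⟨δ, hδ, hfδ⟩ := Metric.uniformContinuous_iff.1 hf ε hε
  set α : ℝ := (4 * C + 1) / δ ^ 2 with hα_def
  have hα : 0 < α := by positivity
  set β : ℕ → ℝ := fun n => 1 / ((n : ℝ) + 1) with hβ_def
  have hβ : ∀ n, 0 < β n := fun n => by positivity
  have hβ1 : ∀ n, β n ≤ 1 := fun n => by
    simp only [hβ_def]
    rw [div_le_one (by positivity)]
    linarith [(Nat.cast_nonneg n : (0 : ℝ) ≤ n)]
  have hβ0 : Tendsto β atTop (𝓝 0) := tendsto_one_div_add_atTop_nhds_zero_nat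
  choose x y hxy using fun n => exists_max_doubling hu husc hv hlsc hα (hβ n)
  have hpen : ∀ n, α * ‖x n - y n‖ ^ 2 + β n * ‖x n‖ ^ 2 ≤ 4 * C := fun n => by
    have h := hxy n 0 0
    simp only [sub_zero, norm_zero] at h
    linarith [(abs_le.1 (hu (x n))).2, (abs_le.1 (hv (y n))).1, (abs_le.1 (hu 0)).1,
      (abs_le.1 (hv 0)).2]
  have hd : ∀ n, ‖x n - y n‖ < δ := fun n => by
    have h1 : 0 ≤ β n * ‖x n‖ ^ 2 := mul_nonneg (hβ n).le (sq_nonneg _)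
    have h2 : α * δ ^ 2 = 4 * C + 1 := by rw [hα_def]; field_simp
    have h3 : α * ‖x n - y n‖ ^ 2 < α * δ ^ 2 := by linarith [hpen n]
    exact lt_of_pow_lt_pow_left₀ 2 hδ.le (lt_of_mul_lt_mul_left h3 hα.le)
  have hβx2 : ∀ n, (β n * ‖x n‖) ^ 2 ≤ β n * (4 * C) := fun n => by
    have h1 : 0 ≤ α * ‖x n - y n‖ ^ 2 := by positivity
    have h2 : β n * ‖x n‖ ^ 2 ≤ 4 * C := by linarith [hpen n]
    calc (β n * ‖x n‖) ^ 2 = β n * (β n * ‖x n‖ ^ 2) := by ring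
      _ ≤ _ := mul_le_mul_of_nonneg_left h2 (hβ n).le
  have hβx0 : ∀ n, 0 ≤ β n * ‖x n‖ := fun n => mul_nonneg (hβ n).le (norm_nonneg _)
  have hβx : Tendsto (fun n => β n * ‖x n‖) atTop (𝓝 0) := by
    have h1 : Tendsto (fun n => √(β n * (4 * C))) atTop (𝓝 0) := by
      have := (Real.continuous_sqrt.tendsto _).comp (hβ0.mul_const (4 * C))
      simpa [Function.comp_def] using this
    exact squeeze_zero hβx0 (fun n => Real.le_sqrt_of_sq_le (hβx2 n)) h1
  have hβxb : ∀ n, β n * ‖x n‖ ≤ 4 * C + 1 := fun n => by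
    nlinarith [hβx2 n, hβ1 n, hβx0 n, hβ n]
  set s : ℕ → RE N := fun n => (2 * α) • (x n - y n) with hs_def
  set p : ℕ → RE N := fun n => s n + (2 * β n) • x n with hp_def
  have hps_eq : ∀ n, ‖p n - s n‖ = 2 * (β n * ‖x n‖) := fun n => by
    simp only [hp_def, add_sub_cancel_left, norm_smul]
    rw [Real.norm_of_nonneg (by linarith [hβ n])]
    ring
  have hps : Tendsto (fun n => ‖p n - s n‖) atTop (𝓝 0) := by
    simpa [hps_eq] using hβx.const_mul 2
  set r : ℝ := 2 * α * δ + 2 * (4 * C + 1) + 1 with hr_def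
  have hr : 0 < r := by positivity
  have hs' : ∀ n, ‖s n‖ ≤ 2 * α * δ := fun n => by
    simp only [hs_def, norm_smul]
    rw [Real.norm_of_nonneg (by positivity)]
    gcongr
    exact (hd n).le
  have hs : ∀ n, ‖s n‖ < r := fun n => by linarith [hs' n]
  have hp : ∀ n, ‖p n‖ < r := fun n => by
    have := norm_le_norm_add_norm_sub' (p n) (s n)
    rw [hps_eq] at this
    linarith [hs' n, hβxb n]
  obtain ⟨B, hB0, hB⟩ := hJ1 r hr
  obtain ⟨ω, hω, hωj⟩ := hJ2 r hr
  have lim₁ := tendsto_integral_norm_sub_sq_of_modulus hm₁ hω hωj hp hs hps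
  have lim₂ := tendsto_integral_min_jump hm₂ hj₂c (K := 4 * C) (by positivity) hα.le
    (fun n => (hβ n).le) hp hs hps (fun n => (hd n).le) hβ0 hβx
  have lim := (((hβ0.mul_const (‖z₀‖ ^ 2)).add ((lim₁.const_mul α).add (hβ0.mul_const B))).add
    lim₂).const_add ε
  simp only [zero_mul, mul_zero, add_zero] at lim
  have key : u z₀ - v z₀ ≤ ε := by
    refine ge_of_tendsto' lim fun n => ?_
    have h1 := doubling_inequality hm₁ hm₂ hj₁i hα.le (hβ n).le hu husc hsub hv hlsc hsuper
      (hxy n) (s := s n) (p := p n) rfl rfl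
    have h2 := hxy n z₀ z₀
    simp only [sub_self, norm_zero] at h2
    have h3 : f (x n) - f (y n) ≤ ε := by
      have := hfδ (a := x n) (b := y n) (by rw [dist_eq_norm]; exact hd n)
      rw [Real.dist_eq] at this
      exact (le_abs_self _).trans this.le
    have h4 : 0 ≤ α * ‖x n - y n‖ ^ 2 + β n * ‖x n‖ ^ 2 :=
      add_nonneg (by positivity) (mul_nonneg (hβ n).le (sq_nonneg _))
    have h5 : ∫ z, (α * ‖j₁ (p n) z - j₁ (s n) z‖ ^ 2 + β n * ‖j₁ (p n) z‖ ^ 2) ∂μ₁ ≤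
        α * ∫ z, ‖j₁ (p n) z - j₁ (s n) z‖ ^ 2 ∂μ₁ + β n * B := by
      have hi : Integrable (fun z => ‖j₁ (p n) z - j₁ (s n) z‖ ^ 2) μ₁ :=
        integrable_norm_sq_of_lintegral_le ((hm₁ _).sub (hm₁ _)) (hωj _ _ (hp n) (hs n))
      rw [integral_add (hi.const_mul α) ((hj₁i _).const_mul _), integral_const_mul,
        integral_const_mul]
      have := integral_norm_sq_le_of_lintegral_le (hm₁ (p n)) hB0.le (hB _ (hp n))
      have := mul_le_mul_of_nonneg_left this (hβ n).le
      linarith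
    linarith
  linarith
end
end

section
/- Uniqueness: Assume (M), (J1), (J2), (F1)–(F4) hold. Then there is at most one bounded continuous viscosity solution u of F(u,Du,L[u,Du]) = f in ℝ^N; that is, if u and v are both bounded continuous viscosity solutions, then u = v. -/
set_option autoImplicit false

open MeasureTheory Filter Topology Metric
open scoped InnerProductSpace ENNReal NNReal

noncomputable section

/-- Viscosity subsolution of `F(u, Du, L[u,Du]) = f` in `ℝ^N`
(test-function formulation with bounded `C²` test functions and global maxima). -/
def IsSubSol {N P : ℕ} (μ₁ μ₂ : Measure (RE P)) (j₁ j₂ : RE N → RE P → RE N)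
    (F : ℝ → RE N → ℝ → ℝ) (f : RE N → ℝ) (u : RE N → ℝ) : Prop :=
  ∀ φ : RE N → ℝ, TestFn φ → ∀ x : RE N, (∀ y, u y - φ y ≤ u x - φ x) →
    F (u x) (gradient φ x) (Lop μ₁ μ₂ j₁ j₂ φ x) ≤ f x

/-- Viscosity supersolution of `F(u, Du, L[u,Du]) = f` in `ℝ^N`. -/
def IsSuperSol {N P : ℕ} (μ₁ μ₂ : Measure (RE P)) (j₁ j₂ : RE N → RE P → RE N)
    (F : ℝ → RE N → ℝ → ℝ) (f : RE N → ℝ) (u : RE N → ℝ) : Prop :=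
  ∀ φ : RE N → ℝ, TestFn φ → ∀ x : RE N, (∀ y, u x - φ x ≤ u y - φ y) →
    f x ≤ F (u x) (gradient φ x) (Lop μ₁ μ₂ j₁ j₂ φ x)

/-- A linear form bounded above by a multiple of the squared norm vanishes. -/
lemma eq_zero_of_inner_le_sq {N : ℕ} {v : RE N} {c : ℝ}
    (h : ∀ k : RE N, ⟪v, k⟫_ℝ ≤ c * ‖k‖ ^ 2) : v = 0 := by
  by_contra hv
  have hv' : 0 < ‖v‖ ^ 2 := by positivity
  have ht : 0 < (|c| + 1)⁻¹ := by positivity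
  have h1 := h ((|c| + 1)⁻¹ • v)
  rw [inner_smul_right, real_inner_self_eq_norm_sq, norm_smul, Real.norm_of_nonneg ht.le] at h1
  have h2 : (|c| + 1)⁻¹ * (|c| + 1) = 1 := inv_mul_cancel₀ (by positivity)
  have h3 : c * (|c| + 1)⁻¹ < 1 := by
    have : c * (|c| + 1)⁻¹ < (|c| + 1) * (|c| + 1)⁻¹ :=
      mul_lt_mul_of_pos_right ((le_abs_self c).trans_lt (lt_add_one _)) ht
    linarith
  have h4 : 0 < (|c| + 1)⁻¹ * ‖v‖ ^ 2 := by positivity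
  nlinarith

/-- A function that is semiconcave and is squeezed between two parabolas at the origin has
increments controlled by an arbitrarily small multiple of `‖h‖ ^ 2` plus a multiple of
`‖h' - h‖ ^ 2`. -/
lemma le_add_sq_of_semiconcave {N : ℕ} {g : RE N → ℝ} {C η : ℝ} (hC : 0 ≤ C) (hη : 0 < η)
    (hg : ∀ h, |g h| ≤ C * ‖h‖ ^ 2)
    (hs : ∀ h, ∃ p : RE N, ∀ k, g (h + k) ≤ g h + ⟪p, k⟫_ℝ + C * ‖k‖ ^ 2) (h h' : RE N) :
    g h' ≤ g h + η * ‖h‖ ^ 2 + (C + 3 * C * ((3 * C + 1) / η)) * ‖h' - h‖ ^ 2 := by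
  obtain ⟨p, hp⟩ := hs h
  have hneg : ∀ k, -⟪p, k⟫_ℝ ≤ 3 * C * ‖h‖ ^ 2 + 3 * C * ‖k‖ ^ 2 := fun k => by
    have h1 := hp k
    have h2 := (abs_le.1 (hg (h + k))).1
    have h3 := (abs_le.1 (hg h)).2
    have h4 : ‖h + k‖ ^ 2 ≤ 2 * ‖h‖ ^ 2 + 2 * ‖k‖ ^ 2 := by
      have := norm_add_le h k
      nlinarith [norm_nonneg (h + k), norm_nonneg h, norm_nonneg k, sq_nonneg (‖h‖ - ‖k‖)]
    nlinarith [mul_le_mul_of_nonneg_left h4 hC]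
  set s := (3 * C + 1) / η with hsdef
  have hs0 : 0 < s := by positivity
  have hsη : 3 * C ≤ η * s := by
    rw [hsdef, mul_div_cancel₀ _ hη.ne']; linarith
  have h1 := hneg (-(s • (h' - h)))
  rw [inner_neg_right, neg_neg, inner_smul_right, norm_neg, norm_smul,
    Real.norm_of_nonneg hs0.le] at h1
  have h2 := hp (h' - h)
  rw [add_sub_cancel] at h2
  have h3 : ⟪p, h' - h⟫_ℝ ≤ η * ‖h‖ ^ 2 + 3 * C * s * ‖h' - h‖ ^ 2 := by
    refine le_of_mul_le_mul_left ?_ hs0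
    nlinarith [mul_le_mul_of_nonneg_right hsη (sq_nonneg ‖h‖)]
  nlinarith

/-- Sup-convolution of a bounded continuous function, together with a selection `Y` of
maximizers and the slopes `q` of the parabolas touching it from below. -/
lemma exists_sup_convolution {N : ℕ} {u : RE N → ℝ} (hu : Continuous u) {K k : ℝ}
    (hK : ∀ x, |u x| ≤ K) (hk : 0 < k) :
    ∃ (U : RE N → ℝ) (q Y : RE N → RE N) (R : ℝ),
      (∀ x, U x = u (Y x) - k * ‖x - Y x‖ ^ 2) ∧ (∀ x y, u y - k * ‖x - y‖ ^ 2 ≤ U x) ∧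
      (∀ x, k * ‖x - Y x‖ ^ 2 ≤ 2 * K) ∧ (∀ x, |U x| ≤ K) ∧
      (∀ x h, U x + ⟪q x, h⟫_ℝ - k * ‖h‖ ^ 2 ≤ U (x + h)) ∧ 0 ≤ R ∧ (∀ x, ‖q x‖ ≤ R) := by
  have hex : ∀ x, ∃ y, ∀ y', u y' - k * ‖x - y'‖ ^ 2 ≤ u y - k * ‖x - y‖ ^ 2 := fun x => by
    refine Continuous.exists_forall_ge (by fun_prop) ?_
    have h1 : Tendsto (fun y => ‖x - y‖) (cocompact (RE N)) atTop := by
      simp only [← dist_eq_norm]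
      exact tendsto_dist_left_cocompact_atTop x
    have h2 : Tendsto (fun y => K - k * ‖x - y‖ ^ 2) (cocompact (RE N)) atBot := by
      simp only [sub_eq_add_neg]
      exact tendsto_atBot_add_const_left _ _ (tendsto_neg_atTop_atBot.comp
        (((tendsto_pow_atTop two_ne_zero).comp h1).const_mul_atTop hk))
    refine tendsto_atBot_mono (fun y => ?_) h2
    linarith [(abs_le.1 (hK y)).2]
  choose Y hY using hex
  have hbd : ∀ x, k * ‖x - Y x‖ ^ 2 ≤ 2 * K := fun x => by
    have h1 := hY x x
    simp only [sub_self, norm_zero] at h1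
    linarith [(abs_le.1 (hK x)).1, (abs_le.1 (hK (Y x))).2]
  refine ⟨fun x => u (Y x) - k * ‖x - Y x‖ ^ 2, fun x => (-(2 * k)) • (x - Y x), Y,
    2 * k * (1 + 2 * K / k), fun x => rfl, hY, hbd, fun x => ?_, fun x h => ?_, ?_, fun x => ?_⟩
  · have h1 := hY x x
    simp only [sub_self, norm_zero] at h1
    have h2 : 0 ≤ k * ‖x - Y x‖ ^ 2 := by positivity
    rw [abs_le]
    constructor
    · linarith [(abs_le.1 (hK x)).1]
    · linarith [(abs_le.1 (hK (Y x))).2]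
  · refine le_trans (le_of_eq ?_) (hY (x + h) (Y x))
    have : x + h - Y x = (x - Y x) + h := by abel
    rw [this, norm_add_sq_real, inner_smul_left]
    simp
    ring
  · have : 0 ≤ K := (abs_nonneg _).trans (hK 0)
    positivity
  · rw [norm_smul, norm_neg, Real.norm_of_nonneg (by positivity)]
    refine mul_le_mul_of_nonneg_left ?_ (by positivity)
    have : ‖x - Y x‖ ^ 2 ≤ 2 * K / k := by
      rw [le_div_iff₀ hk]; linarith [hbd x]
    nlinarith [sq_nonneg (‖x - Y x‖ - 1)]

/-- A function touched from below everywhere by parabolas with bounded slopes has a locally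
uniform modulus of continuity. -/
lemma abs_sub_le_of_subparabola {N : ℕ} {U : RE N → ℝ} {q : RE N → RE N} {k R : ℝ}
    (hU : ∀ x h, U x + ⟪q x, h⟫_ℝ - k * ‖h‖ ^ 2 ≤ U (x + h)) (hq : ∀ x, ‖q x‖ ≤ R)
    (x y : RE N) : |U x - U y| ≤ R * ‖x - y‖ + k * ‖x - y‖ ^ 2 := by
  have key : ∀ x y, U x - U y ≤ R * ‖x - y‖ + k * ‖x - y‖ ^ 2 := fun x y => by
    have h1 := hU x (y - x)
    rw [add_sub_cancel, norm_sub_rev] at h1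
    have h2 := (abs_le.1 (abs_real_inner_le_norm (q x) (y - x))).1
    have h3 := mul_le_mul_of_nonneg_right (hq x) (norm_nonneg (y - x))
    rw [norm_sub_rev y x] at h2 h3
    linarith
  rw [abs_le]
  constructor
  · have := key y x
    rw [norm_sub_rev] at this
    linarith
  · exact key x y

lemma uniformContinuous_of_abs_sub_le {N : ℕ} {U : RE N → ℝ} {k R : ℝ}
    (hU : ∀ x y, |U x - U y| ≤ R * ‖x - y‖ + k * ‖x - y‖ ^ 2) : UniformContinuous U := by
  have h0 : Tendsto (fun t : ℝ => R * t + k * t ^ 2) (𝓝 0) (𝓝 0) := by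
    have : Continuous fun t : ℝ => R * t + k * t ^ 2 := by fun_prop
    simpa using this.tendsto 0
  rw [Metric.uniformContinuous_iff]
  intro ε hε
  obtain ⟨δ, hδ, h⟩ := Metric.tendsto_nhds_nhds.1 h0 ε hε
  refine ⟨δ, hδ, fun {x y} hxy => ?_⟩
  rw [dist_eq_norm] at hxy
  have := h (x := ‖x - y‖) (by simpa using hxy)
  rw [Real.dist_eq, sub_zero] at this
  exact ((hU x y).trans (le_abs_self _)).trans_lt this

/-- A function with a second order expansion at `x` has the corresponding gradient there. -/
lemma gradient_eq_of_abs_le_sq {N : ℕ} {φ : RE N → ℝ} {x q : RE N} {C : ℝ}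
    (h : ∀ k, |φ (x + k) - φ x - ⟪q, k⟫_ℝ| ≤ C * ‖k‖ ^ 2) : gradient φ x = q := by
  refine HasGradientAt.gradient (hasGradientAt_iff_isLittleO_nhds_zero.2 ?_)
  refine (Asymptotics.IsBigO.of_bound C (g := fun k : RE N => ‖k‖ ^ 2)
    (Eventually.of_forall fun k => ?_)).trans_isLittleO ?_
  · simpa using h k
  · exact Asymptotics.isLittleO_norm_pow_id one_lt_two

/-- A bounded uniformly continuous function that lies between two parabolas at `x` can be
approximated uniformly from above by test functions touching it at `x`, with uniform second
order bounds at `x`. -/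
lemma exists_testFn_above {N : ℕ} {w : RE N → ℝ} {x q : RE N} {C : ℝ} (hw : UniformContinuous w)
    (hb : Bdd w) (hC : 0 ≤ C) (hq : ∀ h, |w (x + h) - w x - ⟪q, h⟫_ℝ| ≤ C * ‖h‖ ^ 2)
    {τ : ℝ} (hτ : 0 < τ) :
    ∃ φ : RE N → ℝ, TestFn φ ∧ (∀ y, w y ≤ φ y) ∧ (∀ y, φ y ≤ w y + τ) ∧ φ x = w x ∧
      ∀ h, |φ (x + h) - φ x - ⟪q, h⟫_ℝ| ≤ (C + 2) * ‖h‖ ^ 2 := by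
  obtain ⟨r, hr, hrτ⟩ : ∃ r > 0, (2 * C + 2) * r ^ 2 ≤ τ := by
    have h0 : Tendsto (fun t : ℝ => (2 * C + 2) * t ^ 2) (𝓝[>] 0) (𝓝 0) := by
      have : Continuous fun t : ℝ => (2 * C + 2) * t ^ 2 := by fun_prop
      simpa using (this.tendsto 0).mono_left nhdsWithin_le_nhds
    obtain ⟨r, hr1, hr2⟩ := ((h0.eventually_le_const hτ).and self_mem_nhdsWithin).exists
    exact ⟨r, hr2, hr1⟩
  set b : ContDiffBump x := ⟨r / 2, r, half_pos hr, half_lt_self hr⟩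
  have hs : 0 < (r / 2) ^ 2 := by positivity
  obtain ⟨ψ, hψ, hψw⟩ := hw.exists_contDiff_dist_le hs
  have hψ1 : ∀ y, w y ≤ ψ y + (r / 2) ^ 2 := fun y => by
    have := (abs_lt.1 (Real.dist_eq _ _ ▸ hψw y)).1
    linarith
  have hψ2 : ∀ y, ψ y + (r / 2) ^ 2 ≤ w y + 2 * (r / 2) ^ 2 := fun y => by
    have := (abs_lt.1 (Real.dist_eq _ _ ▸ hψw y)).2
    linarith
  set Q : RE N → ℝ := fun y => w x + ⟪q, y - x⟫_ℝ + C * ‖y - x‖ ^ 2 with hQ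
  have hQ1 : ∀ y, w y ≤ Q y := fun y => by
    have := (abs_le.1 (hq (y - x))).2
    rw [add_sub_cancel] at this
    simp only [hQ]; linarith
  have hQ2 : ∀ y, Q y ≤ w y + 2 * C * ‖y - x‖ ^ 2 := fun y => by
    have := (abs_le.1 (hq (y - x))).1
    rw [add_sub_cancel] at this
    simp only [hQ]; linarith
  set φ : RE N → ℝ := fun y => b y * Q y + (1 - b y) * (ψ y + (r / 2) ^ 2) with hφ
  have hb0 : ∀ y, 0 ≤ b y := fun y => b.nonneg
  have hb1 : ∀ y, 0 ≤ 1 - b y := fun y => sub_nonneg.2 b.le_one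
  have hbx : b x = 1 := b.one_of_mem_closedBall (mem_closedBall_self (by positivity))
  have hlow : ∀ y, w y ≤ φ y := fun y => by
    simp only [hφ]
    nlinarith [mul_le_mul_of_nonneg_left (hQ1 y) (hb0 y),
      mul_le_mul_of_nonneg_left (hψ1 y) (hb1 y)]
  have hup : ∀ y, φ y ≤ w y + τ := fun y => by
    have h2 : ψ y + (r / 2) ^ 2 ≤ w y + (2 * C + 2) * r ^ 2 :=
      (hψ2 y).trans (by nlinarith [mul_nonneg hC (sq_nonneg r), sq_nonneg r])
    have h1 : b y * Q y ≤ b y * (w y + (2 * C + 2) * r ^ 2) := by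
      rcases le_or_gt r (dist y x) with hd | hd
      · rw [b.zero_of_le_dist hd]; simp
      · refine mul_le_mul_of_nonneg_left ((hQ2 y).trans ?_) (hb0 y)
        rw [dist_eq_norm] at hd
        have : ‖y - x‖ ^ 2 ≤ r ^ 2 := pow_le_pow_left₀ (norm_nonneg _) hd.le 2
        nlinarith [mul_le_mul_of_nonneg_left this hC, sq_nonneg r]
    have := mul_le_mul_of_nonneg_left h2 (hb1 y)
    simp only [hφ]
    nlinarith
  have hφx : φ x = w x := by simp [hφ, hQ, hbx]
  refine ⟨φ, ⟨?_, ?_⟩, hlow, hup, hφx, fun h => ?_⟩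
  · have hbc : ContDiff ℝ 2 b := b.contDiff
    have hψc : ContDiff ℝ 2 ψ := contDiff_infty.1 hψ 2
    have hQc : ContDiff ℝ 2 Q := by
      have h1 : ContDiff ℝ 2 fun y : RE N => y - x := contDiff_id.sub contDiff_const
      exact (contDiff_const.add (contDiff_const.inner ℝ h1)).add
        (contDiff_const.mul (h1.norm_sq ℝ))
    exact (hbc.mul hQc).add ((contDiff_const.sub hbc).mul (hψc.add contDiff_const))
  · obtain ⟨K, hK⟩ := hb
    refine ⟨K + τ, fun y => abs_le.2 ⟨?_, ?_⟩⟩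
    · linarith [(abs_le.1 (hK y)).1, hlow y]
    · linarith [(abs_le.1 (hK y)).2, hup y]
  · rw [hφx, abs_le]
    constructor
    · have := (abs_le.1 (hq h)).1
      nlinarith [hlow (x + h), sq_nonneg ‖h‖]
    · have h1 : (1 - b (x + h)) * (ψ (x + h) + (r / 2) ^ 2) ≤
          (1 - b (x + h)) * (w x + ⟪q, h⟫_ℝ + (C + 2) * ‖h‖ ^ 2) := by
        rcases le_or_gt (dist (x + h) x) (r / 2) with hd | hd
        · rw [b.one_of_mem_closedBall (mem_closedBall.2 hd)]; simp
        · refine mul_le_mul_of_nonneg_left ((hψ2 _).trans ?_) (hb1 _)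
          rw [dist_eq_norm, add_sub_cancel_left] at hd
          have h3 : (r / 2) ^ 2 ≤ ‖h‖ ^ 2 := pow_le_pow_left₀ (by positivity) hd.le 2
          linarith [(abs_le.1 (hq h)).2]
      have h2 : b (x + h) * Q (x + h) ≤
          b (x + h) * (w x + ⟪q, h⟫_ℝ + (C + 2) * ‖h‖ ^ 2) := by
        refine mul_le_mul_of_nonneg_left ?_ (hb0 _)
        simp only [hQ, add_sub_cancel_left]
        nlinarith [sq_nonneg ‖h‖]
      have h3 : φ (x + h) ≤ w x + ⟪q, h⟫_ℝ + (C + 2) * ‖h‖ ^ 2 := by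
        simp only [hφ]; linarith
      linarith

/-- The operator `Lop` with the gradient at `x` replaced by a prescribed vector `q`. -/
def LopAt {N P : ℕ} (μ₁ μ₂ : Measure (RE P)) (j₁ j₂ : RE N → RE P → RE N)
    (w : RE N → ℝ) (q x : RE N) : ℝ :=
  (∫ z, (w (x + j₁ q z) - w x - ⟪j₁ q z, q⟫_ℝ) ∂μ₁) + ∫ z, (w (x + j₂ q z) - w x) ∂μ₂

lemma integrable_sq_norm_and_integral_le {N P : ℕ} {μ : Measure (RE P)} {g : RE P → RE N}
    (hg : Measurable g) {C : ℝ} (hC : 0 ≤ C)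
    (h : (∫⁻ z, (‖g z‖₊ : ℝ≥0∞) ^ 2 ∂μ) ≤ ENNReal.ofReal C) :
    Integrable (fun z => ‖g z‖ ^ 2) μ ∧ ∫ z, ‖g z‖ ^ 2 ∂μ ≤ C := by
  have heq : ∀ z, ENNReal.ofReal (‖g z‖ ^ 2) = (‖g z‖₊ : ℝ≥0∞) ^ 2 := fun z => by
    rw [ENNReal.ofReal_pow (norm_nonneg _), ofReal_norm, enorm_eq_nnnorm]
  have hm : AEStronglyMeasurable (fun z => ‖g z‖ ^ 2) μ := (hg.norm.pow_const 2).aestronglyMeasurable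
  constructor
  · refine ⟨hm, ?_⟩
    rw [hasFiniteIntegral_iff_ofReal (Eventually.of_forall fun z => by positivity)]
    simp_rw [heq]
    exact h.trans_lt ENNReal.ofReal_lt_top
  · rw [integral_eq_lintegral_of_nonneg_ae (Eventually.of_forall fun z => by positivity) hm]
    simp_rw [heq]
    exact ENNReal.toReal_le_of_le_ofReal hC h

lemma integrable_of_abs_le_sq {N P : ℕ} {μ : Measure (RE P)} {j : RE P → RE N}
    (hjm : Measurable j) (hj : Integrable (fun z => ‖j z‖ ^ 2) μ) {w : RE N → ℝ}
    (hw : Continuous w) {x q : RE N} {C : ℝ}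
    (hq : ∀ h, |w (x + h) - w x - ⟪q, h⟫_ℝ| ≤ C * ‖h‖ ^ 2) :
    Integrable (fun z => w (x + j z) - w x - ⟪j z, q⟫_ℝ) μ := by
  have hc : Continuous fun h : RE N => w (x + h) - w x - ⟪h, q⟫_ℝ := by fun_prop
  refine (hj.const_mul C).mono' (hc.measurable.comp hjm).aestronglyMeasurable
    (Eventually.of_forall fun z => ?_)
  rw [Real.norm_eq_abs, real_inner_comm]
  exact hq _

lemma integrable_of_abs_le {N P : ℕ} {μ : Measure (RE P)} [IsFiniteMeasure μ] {j : RE P → RE N}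
    (hjm : Measurable j) {w : RE N → ℝ} (hw : Continuous w) {x : RE N} {K : ℝ}
    (hK : ∀ x, |w x| ≤ K) : Integrable (fun z => w (x + j z) - w x) μ := by
  have hc : Continuous fun h : RE N => w (x + h) - w x := by fun_prop
  refine Integrable.of_bound (hc.measurable.comp hjm).aestronglyMeasurable (K + K)
    (Eventually.of_forall fun z => ?_)
  exact (abs_sub _ _).trans (add_le_add (hK _) (hK _))

lemma tendsto_Lop {N P : ℕ} {μ₁ μ₂ : Measure (RE P)} [IsFiniteMeasure μ₂]
    {j₁ j₂ : RE N → RE P → RE N} {w : RE N → ℝ} {x q : RE N} {C K : ℝ}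
    (hj₁m : Measurable (j₁ q)) (hj₂m : Measurable (j₂ q))
    (hj₁ : Integrable (fun z => ‖j₁ q z‖ ^ 2) μ₁) (hK : ∀ x, |w x| ≤ K)
    {φ : ℕ → RE N → ℝ} (hφ : ∀ n, TestFn (φ n))
    (hφw : ∀ n y, |φ n y - w y| ≤ 1 / ((n : ℝ) + 1)) (hφx : ∀ n, φ n x = w x)
    (hφq : ∀ n h, |φ n (x + h) - φ n x - ⟪q, h⟫_ℝ| ≤ C * ‖h‖ ^ 2) :
    Tendsto (fun n => Lop μ₁ μ₂ j₁ j₂ (φ n) x) atTop (𝓝 (LopAt μ₁ μ₂ j₁ j₂ w q x)) := by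
  have hgrad : ∀ n, gradient (φ n) x = q := fun n => gradient_eq_of_abs_le_sq (hφq n)
  have hlim : ∀ y, Tendsto (fun n => φ n y) atTop (𝓝 (w y)) := fun y => by
    rw [tendsto_iff_dist_tendsto_zero]
    exact squeeze_zero (fun _ => dist_nonneg) (fun n => hφw n y)
      tendsto_one_div_add_atTop_nhds_zero_nat
  simp only [Lop, LopAt, hgrad, hφx]
  refine Tendsto.add ?_ ?_
  · refine tendsto_integral_of_dominated_convergence (fun z => C * ‖j₁ q z‖ ^ 2) (fun n => ?_)
      (hj₁.const_mul C) (fun n => Eventually.of_forall fun z => ?_)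
      (Eventually.of_forall fun z => ?_)
    · have := (integrable_of_abs_le_sq hj₁m hj₁ (hφ n).1.continuous (hφq n)).aestronglyMeasurable
      simpa only [hφx] using this
    · rw [Real.norm_eq_abs, real_inner_comm, ← hφx n]
      exact hφq n _
    · exact ((hlim _).sub_const _).sub_const _
  · refine tendsto_integral_of_dominated_convergence (fun _ => K + 1 + K) (fun n => ?_)
      (integrable_const _) (fun n => Eventually.of_forall fun z => ?_)
      (Eventually.of_forall fun z => ?_)
    · obtain ⟨K', hK'⟩ := (hφ n).2
      have := (integrable_of_abs_le (μ := μ₂) (x := x) hj₂m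
        (hφ n).1.continuous hK').aestronglyMeasurable
      simpa only [hφx] using this
    · refine (abs_sub _ _).trans (add_le_add ?_ (hK _))
      have h1 := hφw n (x + j₂ q z)
      have h2 : 1 / ((n : ℝ) + 1) ≤ 1 := by
        rw [div_le_one (by positivity)]
        linarith [n.cast_nonneg (α := ℝ)]
      have h3 := hK (x + j₂ q z)
      rw [abs_le] at h1 h3 ⊢
      constructor <;> linarith
    · exact (hlim _).sub_const _

lemma testFn_comp_add {N : ℕ} {φ : RE N → ℝ} (h : TestFn φ) (c : RE N) :
    TestFn fun y => φ (y + c) :=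
  ⟨h.1.comp (contDiff_id.add contDiff_const), h.2.imp fun _ hK _ => hK _⟩

lemma gradient_comp_add {N : ℕ} (φ : RE N → ℝ) (c y : RE N) :
    gradient (fun y => φ (y + c)) y = gradient φ (y + c) := by
  simp only [gradient, fderiv_comp_add_right]

lemma Lop_comp_add {N P : ℕ} (μ₁ μ₂ : Measure (RE P)) (j₁ j₂ : RE N → RE P → RE N)
    (φ : RE N → ℝ) (c y : RE N) :
    Lop μ₁ μ₂ j₁ j₂ (fun y => φ (y + c)) y = Lop μ₁ μ₂ j₁ j₂ φ (y + c) := by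
  simp only [Lop, gradient_comp_add, add_right_comm]

/-- The subsolution inequality at `y`, tested with a function `U` that is merely punctually
second order at `x`, after a translation mapping `y` to `x`. -/
lemma IsSubSol.le_of_touching {N P : ℕ} {μ₁ μ₂ : Measure (RE P)} [IsFiniteMeasure μ₂]
    {j₁ j₂ : RE N → RE P → RE N} {F : ℝ → RE N → ℝ → ℝ} {f u U : RE N → ℝ}
    (hu : IsSubSol μ₁ μ₂ j₁ j₂ F f u)
    (hF : Continuous fun t : ℝ × RE N × ℝ => F t.1 t.2.1 t.2.2) {x y q : RE N} {C K : ℝ}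
    (hj₁m : Measurable (j₁ q)) (hj₂m : Measurable (j₂ q))
    (hj₁ : Integrable (fun z => ‖j₁ q z‖ ^ 2) μ₁)
    (hU : UniformContinuous U) (hK : ∀ x, |U x| ≤ K) (hC : 0 ≤ C)
    (hq : ∀ h, |U (x + h) - U x - ⟪q, h⟫_ℝ| ≤ C * ‖h‖ ^ 2)
    (ht : ∀ y', u y' - u y ≤ U (y' + (x - y)) - U x) :
    F (u y) q (LopAt μ₁ μ₂ j₁ j₂ U q x) ≤ f y := by
  have hex : ∀ n : ℕ, _ := fun n => exists_testFn_above hU ⟨K, hK⟩ hC hq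
    (τ := 1 / ((n : ℝ) + 1)) (by positivity)
  choose φ hφ hφl hφu hφx hφq using hex
  have hlim := tendsto_Lop (μ₁ := μ₁) (μ₂ := μ₂) (j₁ := j₁) (j₂ := j₂) hj₁m hj₂m hj₁ hK hφ
    (fun n y => abs_le.2 ⟨by linarith [hφl n y, Nat.one_div_pos_of_nat (α := ℝ) (n := n)],
      by linarith [hφu n y]⟩) hφx hφq
  have hFl : Continuous fun l : ℝ => F (u y) q l :=
    hF.comp (f := fun l : ℝ => (u y, q, l)) (by fun_prop)
  refine le_of_tendsto' ((hFl.tendsto _).comp hlim) fun n => ?_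
  have h := hu _ (testFn_comp_add (hφ n) (x - y)) y fun y' => by
    rw [add_sub_cancel, hφx]
    linarith [ht y', hφl n (y' + (x - y))]
  rwa [gradient_comp_add, Lop_comp_add, add_sub_cancel,
    gradient_eq_of_abs_le_sq (hφq n)] at h

/-- The supersolution inequality at `y`, tested with a function `V` that is merely punctually
second order at `x`, after a translation mapping `y` to `x`. -/
lemma IsSuperSol.le_of_touching {N P : ℕ} {μ₁ μ₂ : Measure (RE P)} [IsFiniteMeasure μ₂]
    {j₁ j₂ : RE N → RE P → RE N} {F : ℝ → RE N → ℝ → ℝ} {f v V : RE N → ℝ}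
    (hv : IsSuperSol μ₁ μ₂ j₁ j₂ F f v)
    (hF : Continuous fun t : ℝ × RE N × ℝ => F t.1 t.2.1 t.2.2) {x y p : RE N} {C K : ℝ}
    (hj₁m : Measurable (j₁ p)) (hj₂m : Measurable (j₂ p))
    (hj₁ : Integrable (fun z => ‖j₁ p z‖ ^ 2) μ₁)
    (hV : UniformContinuous V) (hK : ∀ x, |V x| ≤ K) (hC : 0 ≤ C)
    (hp : ∀ h, |V (x + h) - V x - ⟪p, h⟫_ℝ| ≤ C * ‖h‖ ^ 2)
    (ht : ∀ y', V (y' + (x - y)) - V x ≤ v y' - v y) :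
    f y ≤ F (v y) p (LopAt μ₁ μ₂ j₁ j₂ V p x) := by
  have hp' : ∀ h, |(-V (x + h)) - (-V x) - ⟪-p, h⟫_ℝ| ≤ C * ‖h‖ ^ 2 := fun h => by
    rw [← abs_neg, inner_neg_left]
    convert! hp h using 2
    ring
  have hex : ∀ n : ℕ, _ := fun n => exists_testFn_above (w := fun x => -V x) hV.neg
    ⟨K, fun x => by rw [abs_neg]; exact hK x⟩ hC hp' (τ := 1 / ((n : ℝ) + 1)) (by positivity)
  choose ψ hψ hψl hψu hψx hψq using hex
  set φ : ℕ → RE N → ℝ := fun n y => -ψ n y with hφdef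
  have hφ : ∀ n, TestFn (φ n) := fun n =>
    ⟨(hψ n).1.neg, (hψ n).2.imp fun _ h y => by simpa [hφdef] using h y⟩
  have hφx : ∀ n, φ n x = V x := fun n => by simp [hφdef, hψx]
  have hφq : ∀ n h, |φ n (x + h) - φ n x - ⟪p, h⟫_ℝ| ≤ (C + 2) * ‖h‖ ^ 2 := fun n h => by
    have := hψq n h
    rw [← abs_neg, inner_neg_left] at this
    convert! this using 2
    simp only [hφdef]; ring
  have hlim := tendsto_Lop (μ₁ := μ₁) (μ₂ := μ₂) (j₁ := j₁) (j₂ := j₂) hj₁m hj₂m hj₁ hK hφ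
    (fun n y => abs_le.2 ⟨by simp only [hφdef]; linarith [hψu n y],
      by
        simp only [hφdef]
        linarith [hψl n y, Nat.one_div_pos_of_nat (α := ℝ) (n := n)]⟩) hφx hφq
  have hFl : Continuous fun l : ℝ => F (v y) p l :=
    hF.comp (f := fun l : ℝ => (v y, p, l)) (by fun_prop)
  refine ge_of_tendsto' ((hFl.tendsto _).comp hlim) fun n => ?_
  have h := hv _ (testFn_comp_add (hφ n) (x - y)) y fun y' => by
    rw [add_sub_cancel, hφx]
    have := hψl n (y' + (x - y))
    simp only [hφdef]
    linarith [ht y']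
  rwa [gradient_comp_add, Lop_comp_add, add_sub_cancel,
    gradient_eq_of_abs_le_sq (hφq n)] at h

/-- Localized maximization of `U - V` with `U` semiconvex and `V` semiconcave: at a maximum of a
small perturbation the slopes almost agree and the increments are ordered up to a small error. -/
lemma exists_perturbed_max {N : ℕ} {U V : RE N → ℝ} {q p : RE N → RE N} {k K δ : ℝ}
    (hU : Continuous U) (hV : Continuous V) (hUK : ∀ x, |U x| ≤ K) (hVK : ∀ x, |V x| ≤ K)
    (hUq : ∀ x h, U x + ⟪q x, h⟫_ℝ - k * ‖h‖ ^ 2 ≤ U (x + h))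
    (hVp : ∀ x h, V (x + h) ≤ V x + ⟪p x, h⟫_ℝ + k * ‖h‖ ^ 2) (hδ : 0 < δ) (x₀ : RE N) :
    ∃ x, U x₀ - V x₀ - δ ≤ U x - V x ∧ ‖q x - p x‖ ≤ 4 * δ ∧
      (∀ h, U (x + h) - U x ≤ V (x + h) - V x + 2 * δ) ∧
      ∀ h, U (x + h) - U x - ⟪q x, h⟫_ℝ ≤ V (x + h) - V x - ⟪p x, h⟫_ℝ + 2 * δ * ‖h‖ ^ 2 := by
  set G : RE N → ℝ := fun x => U x - V x with hG
  have hbdd : BddAbove (Set.range G) := ⟨K + K, by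
    rintro _ ⟨x, rfl⟩
    simp only [hG]
    linarith [(abs_le.1 (hUK x)).2, (abs_le.1 (hVK x)).1]⟩
  obtain ⟨x₁, hx₁⟩ := exists_lt_of_lt_ciSup (sub_lt_self (⨆ x, G x) hδ)
  set χ : RE N → ℝ := fun y => min (‖y - x₁‖ ^ 2) 1 with hχ
  have hχ0 : ∀ y, 0 ≤ χ y := fun y => le_min (by positivity) zero_le_one
  have hχ1 : ∀ y, χ y ≤ 1 := fun y => min_le_right _ _
  have hχx : χ x₁ = 0 := by simp [hχ]
  have hχc : Continuous χ := by fun_prop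
  obtain ⟨x, -, hx⟩ := (isCompact_closedBall x₁ 1).exists_isMaxOn
    ⟨x₁, mem_closedBall_self zero_le_one⟩
    (f := fun y => G y - 2 * δ * χ y) (by fun_prop : Continuous _).continuousOn
  have hmax₁ : G x₁ ≤ G x - 2 * δ * χ x := by
    have := hx (mem_closedBall_self zero_le_one : x₁ ∈ closedBall x₁ 1)
    simpa [hχx] using this
  have hmax : ∀ y, G y - 2 * δ * χ y ≤ G x - 2 * δ * χ x := fun y => by
    rcases le_or_gt (dist y x₁) 1 with hd | hd
    · exact hx (mem_closedBall.2 hd)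
    · have : χ y = 1 := by
        rw [dist_eq_norm] at hd
        exact min_eq_right (one_le_pow₀ hd.le)
      have h2 := le_ciSup hbdd y
      rw [this]
      linarith
  obtain ⟨d, hd, hdχ⟩ : ∃ d : RE N, ‖d‖ ≤ 2 ∧
      ∀ h, χ (x + h) ≤ χ x + ⟪d, h⟫_ℝ + ‖h‖ ^ 2 := by
    rcases le_or_gt 1 ‖x - x₁‖ with h1 | h1
    · refine ⟨0, by simp, fun h => ?_⟩
      have : χ x = 1 := min_eq_right (one_le_pow₀ h1)
      rw [this, inner_zero_left]
      linarith [hχ1 (x + h), sq_nonneg ‖h‖]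
    · refine ⟨(2 : ℝ) • (x - x₁), ?_, fun h => ?_⟩
      · rw [norm_smul, Real.norm_ofNat]; linarith
      · have : χ x = ‖x - x₁‖ ^ 2 := min_eq_left (pow_le_one₀ (norm_nonneg _) h1.le)
        rw [this]
        refine (min_le_left _ _).trans (le_of_eq ?_)
        rw [add_sub_right_comm, norm_add_sq_real, inner_smul_left]
        simp
  have hinc : ∀ h, U (x + h) - U x ≤ V (x + h) - V x + 2 * δ * (χ (x + h) - χ x) := fun h => by
    have := hmax (x + h)
    simp only [hG] at this
    linarith
  have hqp : q x - p x - (2 * δ) • d = 0 := by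
    refine eq_zero_of_inner_le_sq (c := 2 * k + 2 * δ) fun h => ?_
    rw [inner_sub_left, inner_sub_left, inner_smul_left]
    simp only [conj_trivial]
    have := mul_le_mul_of_nonneg_left (hdχ h) (by positivity : 0 ≤ 2 * δ)
    linarith [hUq x h, hVp x h, hinc h]
  have hqp' : q x - p x = (2 * δ) • d := sub_eq_zero.1 hqp
  refine ⟨x, ?_, ?_, fun h => ?_, fun h => ?_⟩
  · have h1 := le_ciSup hbdd x₀
    have h2 : 0 ≤ 2 * δ * χ x := mul_nonneg (by positivity) (hχ0 x)
    simp only [hG] at h1 hmax₁ hx₁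
    linarith
  · rw [hqp', norm_smul, Real.norm_of_nonneg (by positivity)]
    nlinarith
  · have := mul_le_mul_of_nonneg_left
      (by linarith [hχ1 (x + h), hχ0 x] : χ (x + h) - χ x ≤ 1) (by positivity : 0 ≤ 2 * δ)
    linarith [hinc h]
  · have h1 := mul_le_mul_of_nonneg_left (hdχ h) (by positivity : 0 ≤ 2 * δ)
    have h2 : ⟪q x, h⟫_ℝ - ⟪p x, h⟫_ℝ = 2 * δ * ⟪d, h⟫_ℝ := by
      rw [← inner_sub_left, hqp', inner_smul_left]
      simp
    linarith [hinc h]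

lemma abs_LopAt_le {N P : ℕ} {μ₁ μ₂ : Measure (RE P)} [IsFiniteMeasure μ₂]
    {j₁ j₂ : RE N → RE P → RE N} {w : RE N → ℝ} {q x : RE N} {C K : ℝ}
    (hj₁ : Integrable (fun z => ‖j₁ q z‖ ^ 2) μ₁) (hK : ∀ x, |w x| ≤ K)
    (hq : ∀ h, |w (x + h) - w x - ⟪q, h⟫_ℝ| ≤ C * ‖h‖ ^ 2) :
    |LopAt μ₁ μ₂ j₁ j₂ w q x| ≤ C * ∫ z, ‖j₁ q z‖ ^ 2 ∂μ₁ + (K + K) * μ₂.real Set.univ := by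
  refine (abs_add_le _ _).trans (add_le_add ?_ ?_)
  · rw [← integral_const_mul, ← Real.norm_eq_abs]
    refine norm_integral_le_of_norm_le (hj₁.const_mul C) (Eventually.of_forall fun z => ?_)
    rw [Real.norm_eq_abs, real_inner_comm]
    exact hq _
  · rw [← Real.norm_eq_abs]
    refine norm_integral_le_of_norm_le_const (Eventually.of_forall fun z => ?_)
    exact (abs_sub _ _).trans (add_le_add (hK _) (hK _))

/-- Comparison of the operators at two functions with ordered increments and at different
gradients. -/
lemma LopAt_le_add {N P : ℕ} {μ₁ μ₂ : Measure (RE P)} [IsFiniteMeasure μ₂]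
    {j₁ j₂ : RE N → RE P → RE N} {U V : RE N → ℝ} {q x : RE N} {p : RE N → RE N}
    {C K R k δ η : ℝ} (hC : 0 ≤ C) (hη : 0 < η) (hkC : k ≤ C)
    (hj₁m : ∀ p, Measurable (j₁ p)) (hj₂m : ∀ p, Measurable (j₂ p))
    (hj₁ : ∀ p, Integrable (fun z => ‖j₁ p z‖ ^ 2) μ₁)
    (hj₁' : ∀ p q, Integrable (fun z => ‖j₁ p z - j₁ q z‖ ^ 2) μ₁)
    (hU : Continuous U) (hV : Continuous V) (hUK : ∀ x, |U x| ≤ K) (hVK : ∀ x, |V x| ≤ K)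
    (hVR : ∀ x y, |V x - V y| ≤ R * ‖x - y‖ + k * ‖x - y‖ ^ 2)
    (hVp : ∀ x h, V (x + h) ≤ V x + ⟪p x, h⟫_ℝ + k * ‖h‖ ^ 2)
    (hUC : ∀ h, |U (x + h) - U x - ⟪q, h⟫_ℝ| ≤ C * ‖h‖ ^ 2)
    (hVC : ∀ h, |V (x + h) - V x - ⟪p x, h⟫_ℝ| ≤ C * ‖h‖ ^ 2)
    (hUV₂ : ∀ h, U (x + h) - U x ≤ V (x + h) - V x + 2 * δ)
    (hUV₁ : ∀ h, U (x + h) - U x - ⟪q, h⟫_ℝ ≤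
      V (x + h) - V x - ⟪p x, h⟫_ℝ + 2 * δ * ‖h‖ ^ 2) :
    LopAt μ₁ μ₂ j₁ j₂ U q x ≤ LopAt μ₁ μ₂ j₁ j₂ V (p x) x
      + (2 * δ * ∫ z, ‖j₁ q z‖ ^ 2 ∂μ₁ + η * ∫ z, ‖j₁ (p x) z‖ ^ 2 ∂μ₁
        + (C + 3 * C * ((3 * C + 1) / η)) * ∫ z, ‖j₁ q z - j₁ (p x) z‖ ^ 2 ∂μ₁)
      + (2 * δ * μ₂.real Set.univ + ∫ z, min (K + K) (R * ‖j₂ q z - j₂ (p x) z‖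
        + k * ‖j₂ q z - j₂ (p x) z‖ ^ 2) ∂μ₂) := by
  set g : RE N → ℝ := fun h => V (x + h) - V x - ⟪p x, h⟫_ℝ with hg
  have hgs : ∀ h, ∃ s : RE N, ∀ t, g (h + t) ≤ g h + ⟪s, t⟫_ℝ + C * ‖t‖ ^ 2 := fun h => by
    refine ⟨p (x + h) - p x, fun t => ?_⟩
    have := hVp (x + h) t
    have h2 := mul_le_mul_of_nonneg_right hkC (sq_nonneg ‖t‖)
    simp only [hg, inner_add_right, inner_sub_left, ← add_assoc]
    linarith
  have I₁ : ∫ z, (U (x + j₁ q z) - U x - ⟪j₁ q z, q⟫_ℝ) ∂μ₁ ≤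
      ∫ z, (V (x + j₁ (p x) z) - V x - ⟪j₁ (p x) z, p x⟫_ℝ) ∂μ₁
      + (2 * δ * ∫ z, ‖j₁ q z‖ ^ 2 ∂μ₁ + η * ∫ z, ‖j₁ (p x) z‖ ^ 2 ∂μ₁
        + (C + 3 * C * ((3 * C + 1) / η)) * ∫ z, ‖j₁ q z - j₁ (p x) z‖ ^ 2 ∂μ₁) := by
    have hi := integrable_of_abs_le_sq (hj₁m (p x)) (hj₁ (p x)) hV hVC
    have a1 := (hj₁ q).const_mul (2 * δ)
    have a2 := (hj₁ (p x)).const_mul η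
    have a3 := (hj₁' q (p x)).const_mul (C + 3 * C * ((3 * C + 1) / η))
    rw [← integral_const_mul, ← integral_const_mul, ← integral_const_mul,
      ← integral_add' a1 a2, ← integral_add' (a1.add a2) a3,
      ← integral_add' hi ((a1.add a2).add a3)]
    refine integral_mono (integrable_of_abs_le_sq (hj₁m q) (hj₁ q) hU hUC)
      (hi.add ((a1.add a2).add a3)) fun z => ?_
    have h1 := hUV₁ (j₁ q z)
    have h2 := le_add_sq_of_semiconcave hC hη hVC hgs (j₁ (p x) z) (j₁ q z)
    simp only [Pi.add_apply]
    linarith [real_inner_comm (j₁ q z) q, real_inner_comm (j₁ (p x) z) (p x)]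
  have I₂ : ∫ z, (U (x + j₂ q z) - U x) ∂μ₂ ≤ ∫ z, (V (x + j₂ (p x) z) - V x) ∂μ₂
      + (2 * δ * μ₂.real Set.univ + ∫ z, min (K + K) (R * ‖j₂ q z - j₂ (p x) z‖
        + k * ‖j₂ q z - j₂ (p x) z‖ ^ 2) ∂μ₂) := by
    have hi := integrable_of_abs_le (μ := μ₂) (x := x) (hj₂m (p x)) hV hVK
    have hmod : ∀ z, |V (x + j₂ q z) - V (x + j₂ (p x) z)| ≤
        min (K + K) (R * ‖j₂ q z - j₂ (p x) z‖ + k * ‖j₂ q z - j₂ (p x) z‖ ^ 2) := fun z => by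
      refine le_min ((abs_sub _ _).trans (add_le_add (hVK _) (hVK _))) ?_
      simpa using hVR (x + j₂ q z) (x + j₂ (p x) z)
    have hm : Integrable (fun z => min (K + K) (R * ‖j₂ q z - j₂ (p x) z‖
        + k * ‖j₂ q z - j₂ (p x) z‖ ^ 2)) μ₂ := by
      have hmeas := (hj₂m q).sub (hj₂m (p x))
      have hc : Continuous fun t : RE N => min (K + K) (R * ‖t‖ + k * ‖t‖ ^ 2) := by fun_prop
      refine Integrable.of_bound (hc.measurable.comp hmeas).aestronglyMeasurable (K + K)
        (Eventually.of_forall fun z => ?_)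
      rw [Real.norm_of_nonneg ((abs_nonneg _).trans (hmod z))]
      exact min_le_left _ _
    have hc : Integrable (fun _ : RE P => 2 * δ) μ₂ := integrable_const _
    rw [mul_comm (2 * δ), ← smul_eq_mul (μ₂.real Set.univ), ← integral_const,
      ← integral_add' hc hm, ← integral_add' hi (hc.add hm)]
    refine integral_mono (integrable_of_abs_le (hj₂m q) hU hUK) (hi.add (hc.add hm)) fun z => ?_
    simp only [Pi.add_apply]
    linarith [hUV₂ (j₂ q z), (le_abs_self _).trans (hmod z)]
  simp only [LopAt]
  linarith

lemma tendsto_integral_sq_sub {N P : ℕ} {μ : Measure (RE P)} {j : RE N → RE P → RE N}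
    (hjm : ∀ p, Measurable (j p)) {ω : ℝ → ℝ} (hω : IsModulus ω) {r : ℝ}
    (hJ : ∀ p q : RE N, ‖p‖ < r → ‖q‖ < r →
      (∫⁻ z, (‖j p z - j q z‖₊ : ℝ≥0∞) ^ 2 ∂μ) ≤ ENNReal.ofReal (ω ‖p - q‖))
    {p q : ℕ → RE N} (hp : ∀ n, ‖p n‖ < r) (hq : ∀ n, ‖q n‖ < r)
    (hpq : Tendsto (fun n => q n - p n) atTop (𝓝 0)) :
    Tendsto (fun n => ∫ z, ‖j (q n) z - j (p n) z‖ ^ 2 ∂μ) atTop (𝓝 0) := by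
  rw [Metric.tendsto_nhds]
  intro ε hε
  have h1 := hω.2.2.eventually_lt_const hε
  rw [eventually_nhdsWithin_iff] at h1
  have h2 := (tendsto_zero_iff_norm_tendsto_zero.1 hpq).eventually h1
  filter_upwards [h2] with n hn
  rw [dist_zero_right, Real.norm_of_nonneg (integral_nonneg fun z => by positivity)]
  rcases eq_or_ne (q n) (p n) with h | h
  · simpa [h] using hε
  · exact (integrable_sq_norm_and_integral_le ((hjm _).sub (hjm _)) (hω.1 _)
      (hJ _ _ (hq n) (hp n))).2.trans_lt (hn (norm_pos_iff.2 (sub_ne_zero.2 h)))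

lemma tendsto_integral_min_sub {N P : ℕ} {μ : Measure (RE P)} [IsFiniteMeasure μ]
    {j : RE N → RE P → RE N} (hjm : ∀ p, Measurable (j p))
    (hjc : ∀ᵐ z ∂μ, Continuous fun p => j p z) {K R k : ℝ} (hK : 0 ≤ K) (hR : 0 ≤ R) (hk : 0 ≤ k)
    {p q : ℕ → RE N} {a : RE N} (hp : Tendsto p atTop (𝓝 a)) (hq : Tendsto q atTop (𝓝 a)) :
    Tendsto (fun n => ∫ z, min K (R * ‖j (q n) z - j (p n) z‖
      + k * ‖j (q n) z - j (p n) z‖ ^ 2) ∂μ) atTop (𝓝 0) := by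
  have hc : Continuous fun t : RE N => min K (R * ‖t‖ + k * ‖t‖ ^ 2) := by fun_prop
  have := tendsto_integral_of_dominated_convergence (μ := μ) (f := fun _ => (0 : ℝ))
    (F := fun n z => min K (R * ‖j (q n) z - j (p n) z‖ + k * ‖j (q n) z - j (p n) z‖ ^ 2))
    (fun _ => K) (fun n => (hc.measurable.comp ((hjm (q n)).sub (hjm (p n)))).aestronglyMeasurable)
    (integrable_const _) (fun n => Eventually.of_forall fun z => ?_) ?_
  · simpa using this
  · rw [Real.norm_of_nonneg (le_min hK (by positivity))]
    exact min_le_left _ _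
  · filter_upwards [hjc] with z hz
    have h1 : Tendsto (fun n => j (q n) z - j (p n) z) atTop (𝓝 0) := by
      simpa using ((hz.tendsto a).comp hq).sub ((hz.tendsto a).comp hp)
    simpa [hK, Function.comp_def] using (hc.tendsto 0).comp h1

/-- Comparison principle: bounded continuous subsolutions lie below bounded continuous
supersolutions. -/
theorem le_of_isSubSol_of_isSuperSol {N P : ℕ}
    {μ₁ μ₂ : Measure (RE P)} {j₁ j₂ : RE N → RE P → RE N}
    {F : ℝ → RE N → ℝ → ℝ} {f u v : RE N → ℝ}
    (hM2 : μ₂ Set.univ < ⊤)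
    (hj₁m : Measurable (Function.uncurry j₁))
    (hj₂m : Measurable (Function.uncurry j₂))
    (hj₂c : ∀ᵐ z ∂μ₂, Continuous fun p => j₂ p z)
    (hJ1 : ∀ r > 0, ∃ C > 0, ∀ p : RE N, ‖p‖ < r →
      (∫⁻ z, (‖j₁ p z‖₊ : ℝ≥0∞) ^ 2 ∂μ₁) ≤ ENNReal.ofReal C)
    (hJ2 : ∀ r > 0, ∃ ω : ℝ → ℝ, IsModulus ω ∧ ∀ p q : RE N, ‖p‖ < r → ‖q‖ < r →
      (∫⁻ z, (‖j₁ p z - j₁ q z‖₊ : ℝ≥0∞) ^ 2 ∂μ₁) ≤ ENNReal.ofReal (ω ‖p - q‖))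
    (hF1c : Continuous fun t : ℝ × RE N × ℝ => F t.1 t.2.1 t.2.2)
    (hF1m : ∀ (r : ℝ) (p : RE N) (l l' : ℝ), l ≤ l' → F r p l' ≤ F r p l)
    (hF2 : ∀ M > 0, ∃ γ > 0, ∀ (a b : ℝ) (p : RE N) (l : ℝ),
      -M ≤ b → b ≤ a → a ≤ M → γ * (a - b) ≤ F a p l - F b p l)
    (hf : UniformContinuous f)
    (hub : Bdd u) (huc : Continuous u) (husub : IsSubSol μ₁ μ₂ j₁ j₂ F f u)
    (hvb : Bdd v) (hvc : Continuous v) (hvsuper : IsSuperSol μ₁ μ₂ j₁ j₂ F f v) (x₀ : RE N) :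
    u x₀ ≤ v x₀ := by
  have : IsFiniteMeasure μ₂ := ⟨hM2⟩
  by_contra! hlt
  set m := u x₀ - v x₀ with hm
  have hm0 : 0 < m := sub_pos.2 hlt
  obtain ⟨K, hK0, hu, hv⟩ : ∃ K > 0, (∀ x, |u x| ≤ K) ∧ ∀ x, |v x| ≤ K := by
    obtain ⟨A, hA⟩ := hub
    obtain ⟨B, hB⟩ := hvb
    exact ⟨max A B + 1, by linarith [le_max_left A B, (abs_nonneg _).trans (hA 0)],
      fun x => by linarith [hA x, le_max_left A B], fun x => by linarith [hB x, le_max_right A B]⟩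
  obtain ⟨γ, hγ0, hγ⟩ := hF2 K hK0
  obtain ⟨η, hη0, hη⟩ := Metric.uniformContinuous_iff.1 hf (γ * m / 2) (by positivity)
  obtain ⟨k, hk0, hk⟩ : ∃ k > 0, 2 * K < k * (η / 2) ^ 2 :=
    ⟨(2 * K + 1) / (η / 2) ^ 2, by positivity, by
      rw [div_mul_cancel₀ _ (by positivity)]; linarith⟩
  have hclose : ∀ x y : RE N, k * ‖x - y‖ ^ 2 ≤ 2 * K → ‖x - y‖ < η / 2 := fun x y h => by
    by_contra! hle
    nlinarith [mul_le_mul_of_nonneg_left (pow_le_pow_left₀ (by positivity) hle 2) hk0.le]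
  obtain ⟨U, q, Yu, Ru, hU1, hU2, hU3, hUK, hUq, hRu0, hRu⟩ := exists_sup_convolution huc hu hk0
  obtain ⟨V', p', Yv, Rv, hV1, hV2, hV3, hVK', hVq, hRv0, hRv⟩ :=
    exists_sup_convolution (u := fun x => -v x) hvc.neg
      (fun x => by rw [abs_neg]; exact hv x) hk0
  have hUR := abs_sub_le_of_subparabola hUq hRu
  have hUu := uniformContinuous_of_abs_sub_le hUR
  set V : RE N → ℝ := fun x => -V' x with hVdef
  set p : RE N → RE N := fun x => -p' x with hpdef
  have hpR : ∀ x, ‖p x‖ ≤ Rv := fun x => by simpa [hpdef] using hRv x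
  have hVR : ∀ x y, |V x - V y| ≤ Rv * ‖x - y‖ + k * ‖x - y‖ ^ 2 := fun x y => by
    have := abs_sub_le_of_subparabola hVq hRv x y
    rw [← abs_neg] at this
    convert! this using 2
    simp only [hVdef]; ring
  have hVu := uniformContinuous_of_abs_sub_le hVR
  have hVK : ∀ x, |V x| ≤ K := fun x => by simpa [hVdef] using hVK' x
  have hVp : ∀ x h, V (x + h) ≤ V x + ⟪p x, h⟫_ℝ + k * ‖h‖ ^ 2 := fun x h => by
    simp only [hVdef, hpdef, inner_neg_left]
    linarith [hVq x h]
  have hj₁p : ∀ p, Measurable (j₁ p) := fun p => hj₁m.of_uncurry_left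
  have hj₂p : ∀ p, Measurable (j₂ p) := fun p => hj₂m.of_uncurry_left
  have hj₁i : ∀ p, Integrable (fun z => ‖j₁ p z‖ ^ 2) μ₁ := fun p => by
    obtain ⟨C, hC, h⟩ := hJ1 (‖p‖ + 1) (by positivity)
    exact (integrable_sq_norm_and_integral_le (hj₁p p) hC.le (h p (lt_add_one _))).1
  have hj₁d : ∀ p q, Integrable (fun z => ‖j₁ p z - j₁ q z‖ ^ 2) μ₁ := fun p q => by
    obtain ⟨ω, hω, h⟩ := hJ2 (‖p‖ + ‖q‖ + 1) (by positivity)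
    exact (integrable_sq_norm_and_integral_le ((hj₁p p).sub (hj₁p q)) (hω.1 _)
      (h p q (by linarith [norm_nonneg q]) (by linarith [norm_nonneg p]))).1
  set r := Ru + Rv + 1 with hr
  have hr0 : 0 < r := by positivity
  obtain ⟨J, hJ0, hJ⟩ := hJ1 r hr0
  obtain ⟨ω, hω, hωJ⟩ := hJ2 r hr0
  have hJi : ∀ p, ‖p‖ < r → ∫ z, ‖j₁ p z‖ ^ 2 ∂μ₁ ≤ J := fun p hp =>
    (integrable_sq_norm_and_integral_le (hj₁p p) hJ0.le (hJ p hp)).2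
  have hqr : ∀ x, ‖q x‖ < r := fun x => by linarith [hRu x]
  have hpr : ∀ x, ‖p x‖ < r := fun x => by linarith [hpR x]
  set δ : ℕ → ℝ := fun n => 1 / ((n : ℝ) + 1) with hδ
  have hδ0 : ∀ n, 0 < δ n := fun n => Nat.one_div_pos_of_nat
  have hδ1 : ∀ n, δ n ≤ 1 := fun n => by
    simp only [hδ]
    rw [div_le_one (by positivity)]
    linarith [n.cast_nonneg (α := ℝ)]
  have hδlim : Tendsto δ atTop (𝓝 0) := tendsto_one_div_add_atTop_nhds_zero_nat
  choose x hx1 hx2 hx3 hx4 using fun n => exists_perturbed_max hUu.continuous hVu.continuous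
    hUK hVK hUq hVp (hδ0 n) x₀
  set C := k + 2 with hC
  have hC0 : 0 ≤ C := by positivity
  have hUC : ∀ n h, |U (x n + h) - U (x n) - ⟪q (x n), h⟫_ℝ| ≤ C * ‖h‖ ^ 2 := fun n h => by
    have := mul_le_mul_of_nonneg_right (hδ1 n) (sq_nonneg ‖h‖)
    rw [abs_le, hC]
    constructor
    · nlinarith [hUq (x n) h, sq_nonneg ‖h‖]
    · linarith [hx4 n h, hVp (x n) h]
  have hVC : ∀ n h, |V (x n + h) - V (x n) - ⟪p (x n), h⟫_ℝ| ≤ C * ‖h‖ ^ 2 := fun n h => by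
    have := mul_le_mul_of_nonneg_right (hδ1 n) (sq_nonneg ‖h‖)
    rw [abs_le, hC]
    constructor
    · linarith [hx4 n h, hUq (x n) h]
    · nlinarith [hVp (x n) h, sq_nonneg ‖h‖]
  set l : ℕ → ℝ := fun n => LopAt μ₁ μ₂ j₁ j₂ U (q (x n)) (x n) with hl
  set l' : ℕ → ℝ := fun n => LopAt μ₁ μ₂ j₁ j₂ V (p (x n)) (x n) with hl'
  set a : ℕ → ℝ := fun n => u (Yu (x n)) with ha
  set b : ℕ → ℝ := fun n => v (Yv (x n)) with hb
  have hsub : ∀ n, F (a n) (q (x n)) (l n) ≤ f (Yu (x n)) := fun n =>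
    husub.le_of_touching hF1c (hj₁p _) (hj₂p _) (hj₁i _) hUu hUK hC0 (hUC n) fun y' => by
      have h1 := hU2 (y' + (x n - Yu (x n))) y'
      rw [add_sub_cancel_left] at h1
      linarith [hU1 (x n)]
  have hsuper : ∀ n, f (Yv (x n)) ≤ F (b n) (p (x n)) (l' n) := fun n =>
    hvsuper.le_of_touching hF1c (hj₁p _) (hj₂p _) (hj₁i _) hVu hVK hC0 (hVC n) fun y' => by
      have h1 := hV2 (y' + (x n - Yv (x n))) y'
      rw [add_sub_cancel_left] at h1
      simp only [hVdef]
      linarith [hV1 (x n)]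
  have hff : ∀ n, f (Yu (x n)) ≤ f (Yv (x n)) + γ * m / 2 := fun n => by
    have hd : dist (Yu (x n)) (Yv (x n)) < η := by
      have h1 := hclose _ _ (hU3 (x n))
      have h2 := hclose _ _ (hV3 (x n))
      have h3 := dist_triangle_left (Yu (x n)) (Yv (x n)) (x n)
      rw [dist_eq_norm (x n), dist_eq_norm (x n)] at h3
      linarith
    have := (abs_lt.1 (Real.dist_eq _ _ ▸ hη hd)).2
    linarith
  have hFn : ∀ n, F (a n) (q (x n)) (l n) ≤ F (b n) (p (x n)) (l' n) + γ * m / 2 := fun n => by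
    linarith [hsub n, hsuper n, hff n]
  have habn : ∀ n, m - δ n ≤ a n - b n := fun n => by
    have h1 := hU2 x₀ x₀
    have h2 := hV2 x₀ x₀
    simp only [sub_self, norm_zero] at h1 h2
    have h3 : 0 ≤ k * ‖x n - Yu (x n)‖ ^ 2 := by positivity
    have h4 : 0 ≤ k * ‖x n - Yv (x n)‖ ^ 2 := by positivity
    have h5 := hx1 n
    simp only [hVdef] at h5
    linarith [hU1 (x n), hV1 (x n)]
  set B := C * J + (K + K) * μ₂.real Set.univ with hB
  have hlB : ∀ n, |l n| ≤ B := fun n =>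
    (abs_LopAt_le (hj₁i _) hUK (hUC n)).trans (by
      have := mul_le_mul_of_nonneg_left (hJi _ (hqr (x n))) hC0
      linarith)
  have hlB' : ∀ n, |l' n| ≤ B := fun n =>
    (abs_LopAt_le (hj₁i _) hVK (hVC n)).trans (by
      have := mul_le_mul_of_nonneg_left (hJi _ (hpr (x n))) hC0
      linarith)
  obtain ⟨⟨a₀, b₀, q₀, l₀, l₀'⟩, -, σ, hσ, hlim⟩ :=
    ((isCompact_Icc (a := -K) (b := K)).prod ((isCompact_Icc (a := -K) (b := K)).prod
      ((isCompact_closedBall (0 : RE N) r).prod ((isCompact_Icc (a := -B) (b := B)).prod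
        (isCompact_Icc (a := -B) (b := B)))))).tendsto_subseq
      (x := fun n => (a n, b n, q (x n), l n, l' n))
      (fun n => ⟨abs_le.1 (hu _), abs_le.1 (hv _), mem_closedBall_zero_iff.2 (hqr _).le,
        abs_le.1 (hlB n), abs_le.1 (hlB' n)⟩)
  have ta : Tendsto (fun n => a (σ n)) atTop (𝓝 a₀) := hlim.fst_nhds
  have tb : Tendsto (fun n => b (σ n)) atTop (𝓝 b₀) := hlim.snd_nhds.fst_nhds
  have tq : Tendsto (fun n => q (x (σ n))) atTop (𝓝 q₀) := hlim.snd_nhds.snd_nhds.fst_nhds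
  have tl : Tendsto (fun n => l (σ n)) atTop (𝓝 l₀) := hlim.snd_nhds.snd_nhds.snd_nhds.fst_nhds
  have tl' : Tendsto (fun n => l' (σ n)) atTop (𝓝 l₀') :=
    hlim.snd_nhds.snd_nhds.snd_nhds.snd_nhds
  have tδ : Tendsto (fun n => δ (σ n)) atTop (𝓝 0) := hδlim.comp hσ.tendsto_atTop
  have tqp : Tendsto (fun n => q (x (σ n)) - p (x (σ n))) atTop (𝓝 0) :=
    squeeze_zero_norm (fun n => hx2 (σ n)) (by simpa using tδ.const_mul 4)
  have tp : Tendsto (fun n => p (x (σ n))) atTop (𝓝 q₀) := by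
    simpa using tq.sub tqp
  have hll : l₀ ≤ l₀' := by
    have tJ := tendsto_integral_sq_sub hj₁p hω hωJ (fun n => hpr (x (σ n)))
      (fun n => hqr (x (σ n))) tqp
    have tR := tendsto_integral_min_sub hj₂p hj₂c (add_nonneg hK0.le hK0.le) hRv0 hk0.le tp tq
    refine le_of_forall_pos_le_add fun ε hε => ?_
    have hεJ : 0 < ε / J := div_pos hε hJ0
    have hkC : k ≤ C := by linarith
    have hbound : ∀ n, l (σ n) ≤ l' (σ n) + (2 * δ (σ n) * J + ε +
        (C + 3 * C * ((3 * C + 1) / (ε / J))) *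
          ∫ z, ‖j₁ (q (x (σ n))) z - j₁ (p (x (σ n))) z‖ ^ 2 ∂μ₁) +
        (2 * δ (σ n) * μ₂.real Set.univ + ∫ z, min (K + K)
          (Rv * ‖j₂ (q (x (σ n))) z - j₂ (p (x (σ n))) z‖ +
            k * ‖j₂ (q (x (σ n))) z - j₂ (p (x (σ n))) z‖ ^ 2) ∂μ₂) := fun n => by
      refine (LopAt_le_add hC0 hεJ hkC hj₁p hj₂p hj₁i hj₁d hUu.continuous hVu.continuous hUK hVK
        hVR hVp (hUC (σ n)) (hVC (σ n)) (hx3 (σ n)) (hx4 (σ n))).trans ?_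
      have h1 := mul_le_mul_of_nonneg_left (hJi _ (hqr (x (σ n))))
        (by linarith [hδ0 (σ n)] : 0 ≤ 2 * δ (σ n))
      have h2 := mul_le_mul_of_nonneg_left (hJi _ (hpr (x (σ n)))) hεJ.le
      rw [div_mul_cancel₀ _ hJ0.ne'] at h2
      gcongr
    refine le_of_tendsto_of_tendsto' tl ?_ hbound
    have t2δ := tδ.const_mul 2
    simpa using (tl'.add (((t2δ.mul_const J).add_const ε).add (tJ.const_mul
      (C + 3 * C * ((3 * C + 1) / (ε / J)))))).add ((t2δ.mul_const (μ₂.real Set.univ)).add tR)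
  have hab : m - 0 ≤ a₀ - b₀ :=
    le_of_tendsto_of_tendsto' (tδ.const_sub m) (ta.sub tb) fun n => habn (σ n)
  rw [sub_zero] at hab
  have hF₀ : F a₀ q₀ l₀ ≤ F b₀ q₀ l₀' + γ * m / 2 := by
    refine le_of_tendsto_of_tendsto' (b := atTop) ?_ (Tendsto.add_const _ ?_) fun n => hFn (σ n)
    · exact (hF1c.tendsto (a₀, q₀, l₀)).comp (ta.prodMk_nhds (tq.prodMk_nhds tl))
    · exact (hF1c.tendsto (b₀, q₀, l₀')).comp (tb.prodMk_nhds (tp.prodMk_nhds tl'))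
  have hb₀ : -K ≤ b₀ := ge_of_tendsto' tb fun n => (abs_le.1 (hv _)).1
  have ha₀ : a₀ ≤ K := le_of_tendsto' ta fun n => (abs_le.1 (hu _)).2
  have h1 := hγ a₀ b₀ q₀ l₀ hb₀ (by linarith) ha₀
  have h2 := hF1m b₀ q₀ l₀ l₀' hll
  have h3 := mul_le_mul_of_nonneg_left hab hγ0.le
  have h4 : 0 < γ * m := mul_pos hγ0 hm0
  linarith

/-- Uniqueness of bounded continuous viscosity solutions of
`F(u, Du, L[u,Du]) = f` in `ℝ^N`. -/
theorem uniqueness_fully_nonlinear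
    (N P : ℕ) (hN : 1 ≤ N) (hP : 1 ≤ P)
    (μ₁ μ₂ : Measure (RE P)) (j₁ j₂ : RE N → RE P → RE N)
    (F : ℝ → RE N → ℝ → ℝ) (f u v : RE N → ℝ)
    -- (M)
    (hM0 : μ₁ {0} = 0) (hM0' : μ₂ {0} = 0)
    (hM1 : (∫⁻ z, (‖z‖₊ : ℝ≥0∞) ^ 2 ∂μ₁) < ⊤)
    (hM2 : μ₂ Set.univ < ⊤)
    -- j measurable and continuous in p for a.e. z
    (hj₁m : Measurable (Function.uncurry j₁))
    (hj₂m : Measurable (Function.uncurry j₂))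
    (hj₁c : ∀ᵐ z ∂μ₁, Continuous fun p => j₁ p z)
    (hj₂c : ∀ᵐ z ∂μ₂, Continuous fun p => j₂ p z)
    -- (J1)
    (hJ1 : ∀ r > 0, ∃ C > 0, ∀ p : RE N, ‖p‖ < r →
      (∫⁻ z, (‖j₁ p z‖₊ : ℝ≥0∞) ^ 2 ∂μ₁) ≤ ENNReal.ofReal C)
    -- (J2)
    (hJ2 : ∀ r > 0, ∃ ω : ℝ → ℝ, IsModulus ω ∧ ∀ p q : RE N, ‖p‖ < r → ‖q‖ < r →
      (∫⁻ z, (‖j₁ p z - j₁ q z‖₊ : ℝ≥0∞) ^ 2 ∂μ₁) ≤ ENNReal.ofReal (ω ‖p - q‖))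
    -- (F1)
    (hF1c : Continuous fun t : ℝ × RE N × ℝ => F t.1 t.2.1 t.2.2)
    (hF1m : ∀ (r : ℝ) (p : RE N) (l l' : ℝ), l ≤ l' → F r p l' ≤ F r p l)
    -- (F2)
    (hF2 : ∀ M > 0, ∃ γ > 0, ∀ (a b : ℝ) (p : RE N) (l : ℝ),
      -M ≤ b → b ≤ a → a ≤ M → γ * (a - b) ≤ F a p l - F b p l)
    -- (F3)
    (hF3 : ∀ M > 0, ∀ r > 0, ∃ ω : ℝ → ℝ, IsModulus ω ∧
      ∀ (a : ℝ) (p q : RE N) (l l' : ℝ), |a| ≤ M → ‖p‖ ≤ r → ‖q‖ ≤ r → |l| ≤ r → |l'| ≤ r →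
        |F a p l - F a q l'| ≤ ω (‖p - q‖ + |l - l'|))
    -- (F4)
    (hf : UniformContinuous f)
    -- u, v : bounded continuous viscosity solutions
    (hub : Bdd u) (huc : Continuous u)
    (husub : IsSubSol μ₁ μ₂ j₁ j₂ F f u) (husuper : IsSuperSol μ₁ μ₂ j₁ j₂ F f u)
    (hvb : Bdd v) (hvc : Continuous v)
    (hvsub : IsSubSol μ₁ μ₂ j₁ j₂ F f v) (hvsuper : IsSuperSol μ₁ μ₂ j₁ j₂ F f v) :
    u = v := by
  have cmp : ∀ {a b : RE N → ℝ}, Bdd a → Continuous a → IsSubSol μ₁ μ₂ j₁ j₂ F f a →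
      Bdd b → Continuous b → IsSuperSol μ₁ μ₂ j₁ j₂ F f b → ∀ x, a x ≤ b x :=
    fun ha hac has hb hbc hbs =>
      le_of_isSubSol_of_isSuperSol hM2 hj₁m hj₂m hj₂c hJ1 hJ2 hF1c hF1m hF2 hf ha hac has hb hbc hbs
  funext x
  exact le_antisymm (cmp hub huc husub hvb hvc hvsuper x) (cmp hvb hvc hvsub hub huc husuper x)
end
end
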